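/- Let M ⊆ N₁, N₂ ⊆ N ⊆ B(H) with conditional expectations E^M, E₁, E₂ compatible with a common full-rank state σ, and let E^{(0),M}, E₁^{(0)}, E₂^{(0)} be the trace-preserving (Hilbert–Schmidt self-adjoint) conditional expectations onto the same algebras. Suppose AT(1,d) holds at 'infinite temperature': for all positive semidefinite X, D_Lin(X‖E^{(0),M}_*(X)) ≤ D_Lin(X‖E^{(0)}_{1*}(X)) + D_Lin(X‖E^{(0)}_{2*}(X)) + d. Then for every state ρ: D(ρ‖E^M_*(ρ)) ≤ (λ_max(σ)/λ_min(σ)) · (D(ρ‖E₁_*(ρ)) + D(ρ‖E₂_*(ρ))) + λ_max(σ) d_H d. -/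

import Mathlib

open Matrix ComplexOrder

noncomputable section

def matLog {d : ℕ} (A : Matrix (Fin d) (Fin d) ℂ) : Matrix (Fin d) (Fin d) ℂ :=
  cfc Real.log A

def relEnt {d : ℕ} (ρ σ : Matrix (Fin d) (Fin d) ℂ) : ℝ :=
  ((ρ * (matLog ρ - matLog σ)).trace).re

/-- Lindblad relative entropy `D_Lin(A‖B) := Tr[A(log A − log B)] − Tr[A] + Tr[B]`. -/
def DLin {d : ℕ} (A B : Matrix (Fin d) (Fin d) ℂ) : ℝ :=
  ((A * (matLog A - matLog B)).trace).re - (A.trace).re + (B.trace).re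

namespace ATCM

open Finset

/-- `U diag(a) Uᴴ` for a real vector `a`. -/
def udu {d : ℕ} (U : Matrix (Fin d) (Fin d) ℂ) (a : Fin d → ℝ) : Matrix (Fin d) (Fin d) ℂ :=
  U * diagonal (fun i => (a i : ℂ)) * Uᴴ

lemma udu_herm {d : ℕ} (U : Matrix (Fin d) (Fin d) ℂ) (a : Fin d → ℝ) :
    (udu U a).IsHermitian := by
  unfold udu Matrix.IsHermitian
  have : (diagonal (fun i => (a i : ℂ)))ᴴ = diagonal (fun i => (a i : ℂ)) := by
    rw [Matrix.diagonal_conjTranspose]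
    congr 1
    ext i
    simp
  rw [Matrix.conjTranspose_mul, Matrix.conjTranspose_mul, this, conjTranspose_conjTranspose,
    Matrix.mul_assoc]

lemma udu_mul {d : ℕ} {U : Matrix (Fin d) (Fin d) ℂ} (hU : Uᴴ * U = 1) (a b : Fin d → ℝ) :
    udu U a * udu U b = udu U (fun i => a i * b i) := by
  unfold udu
  calc _ = U * diagonal (fun i => (a i : ℂ)) * (Uᴴ * U) * diagonal (fun i => (b i : ℂ)) * Uᴴ := by
        simp only [Matrix.mul_assoc]
    _ = _ := by
        rw [hU, Matrix.mul_one, Matrix.mul_assoc U, diagonal_mul_diagonal]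
        simp

lemma udu_add {d : ℕ} (U : Matrix (Fin d) (Fin d) ℂ) (a b : Fin d → ℝ) :
    udu U a + udu U b = udu U (fun i => a i + b i) := by
  unfold udu
  rw [← Matrix.add_mul, ← Matrix.mul_add, diagonal_add]
  simp

lemma udu_smul {d : ℕ} (U : Matrix (Fin d) (Fin d) ℂ) (r : ℝ) (a : Fin d → ℝ) :
    r • udu U a = udu U (fun i => r * a i) := by
  unfold udu
  rw [← Matrix.smul_mul, ← Matrix.mul_smul]
  congr 2
  ext i j
  by_cases h : i = j <;> simp [h, diagonal]

lemma udu_const {d : ℕ} {U : Matrix (Fin d) (Fin d) ℂ} (hU' : U * Uᴴ = 1) (r : ℝ) :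
    udu U (fun _ => r) = r • (1 : Matrix (Fin d) (Fin d) ℂ) := by
  have : (diagonal (fun _ : Fin d => (r : ℂ))) = r • (1 : Matrix (Fin d) (Fin d) ℂ) := by
    ext i j
    by_cases h : i = j <;> simp [h]
  unfold udu
  rw [this]
  simp [hU']

lemma udu_aeval {d : ℕ} {U : Matrix (Fin d) (Fin d) ℂ} (hU : Uᴴ * U = 1) (hU' : U * Uᴴ = 1)
    (a : Fin d → ℝ) (p : Polynomial ℝ) :
    Polynomial.aeval (udu U a) p = udu U (fun i => p.eval (a i)) := by
  induction p using Polynomial.induction_on' with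
  | add p q hp hq => simp [hp, hq, udu_add]
  | monomial n r =>
    rw [Polynomial.aeval_monomial]
    have hpow : ∀ n : ℕ, (udu U a) ^ n = udu U (fun i => a i ^ n) := by
      intro n
      induction n with
      | zero => simp [udu_const hU']
      | succ n ih => rw [pow_succ, ih, udu_mul hU]; simp [pow_succ]
    rw [hpow, Algebra.algebraMap_eq_smul_one, smul_mul_assoc, one_mul, udu_smul]
    simp

lemma exists_poly (S : Set ℝ) (hS : S.Finite) (f : ℝ → ℝ) :
    ∃ p : Polynomial ℝ, ∀ x ∈ S, p.eval x = f x := by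
  refine ⟨Lagrange.interpolate hS.toFinset id f, fun x hx => ?_⟩
  exact Lagrange.eval_interpolate_at_node (v := id) f (Function.injective_id.injOn)
    (hS.mem_toFinset.2 hx)

lemma cfc_poly {d : ℕ} {A : Matrix (Fin d) (Fin d) ℂ} (hA : A.IsHermitian) (f : ℝ → ℝ)
    (p : Polynomial ℝ) (hp : ∀ x ∈ spectrum ℝ A, p.eval x = f x) :
    cfc f A = Polynomial.aeval A p := by
  rw [← cfc_polynomial p A hA.isSelfAdjoint]
  exact cfc_congr fun x hx => (hp x hx).symm

lemma exists_cfc_poly {d : ℕ} {A : Matrix (Fin d) (Fin d) ℂ} (hA : A.IsHermitian) (f : ℝ → ℝ) :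
    ∃ p : Polynomial ℝ, cfc f A = Polynomial.aeval A p := by
  obtain ⟨p, hp⟩ := exists_poly (spectrum ℝ A) (Matrix.finite_real_spectrum) f
  exact ⟨p, cfc_poly hA f p hp⟩

lemma cfc_udu {d : ℕ} {U : Matrix (Fin d) (Fin d) ℂ} (hU : Uᴴ * U = 1) (hU' : U * Uᴴ = 1)
    (a : Fin d → ℝ) (f : ℝ → ℝ) :
    cfc f (udu U a) = udu U (fun i => f (a i)) := by
  obtain ⟨p, hp⟩ := exists_poly (spectrum ℝ (udu U a) ∪ Set.range a)
    ((Matrix.finite_real_spectrum).union (Set.finite_range a)) f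
  rw [cfc_poly (udu_herm U a) f p (fun x hx => hp x (Or.inl hx)), udu_aeval hU hU']
  congr 1
  ext i
  exact hp _ (Or.inr ⟨i, rfl⟩)

lemma aeval_mem' {d : ℕ} (S : Subalgebra ℝ (Matrix (Fin d) (Fin d) ℂ))
    {A : Matrix (Fin d) (Fin d) ℂ} (hA : A ∈ S) (p : Polynomial ℝ) : Polynomial.aeval A p ∈ S :=
  (Algebra.adjoin_le (Set.singleton_subset_iff.2 hA)) (Polynomial.aeval_mem_adjoin_singleton ℝ A)

lemma cfc_mem {d : ℕ} (N : StarSubalgebra ℂ (Matrix (Fin d) (Fin d) ℂ))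
    {A : Matrix (Fin d) (Fin d) ℂ} (hA : A.IsHermitian) (hN : A ∈ N) (f : ℝ → ℝ) :
    cfc f A ∈ N := by
  obtain ⟨p, hp⟩ := exists_cfc_poly hA f
  rw [hp]
  have := aeval_mem' (N.toSubalgebra.restrictScalars ℝ) (A := A) hN p
  exact this

lemma cfc_comm {d : ℕ} {A B : Matrix (Fin d) (Fin d) ℂ} (hA : A.IsHermitian)
    (h : Commute A B) (f : ℝ → ℝ) : Commute (cfc f A) B := by
  obtain ⟨p, hp⟩ := exists_cfc_poly hA f
  rw [hp]
  have hmem : A ∈ Subalgebra.centralizer ℝ ({B} : Set (Matrix (Fin d) (Fin d) ℂ)) := by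
    rw [Subalgebra.mem_centralizer_iff]
    intro g hg
    rw [Set.mem_singleton_iff.1 hg]
    exact h.symm.eq
  have := aeval_mem' _ hmem p
  rw [Subalgebra.mem_centralizer_iff] at this
  exact (this B rfl).symm

lemma exists_udu {d : ℕ} {A : Matrix (Fin d) (Fin d) ℂ} (hA : A.IsHermitian) :
    ∃ U : Matrix (Fin d) (Fin d) ℂ, Uᴴ * U = 1 ∧ U * Uᴴ = 1 ∧ A = udu U hA.eigenvalues := by
  refine ⟨hA.eigenvectorUnitary, ?_, ?_, ?_⟩
  · exact Unitary.coe_star_mul_self hA.eigenvectorUnitary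
  · exact Unitary.coe_mul_star_self hA.eigenvectorUnitary
  · conv_lhs => rw [hA.spectral_theorem]
    rfl

lemma joint_diag {d : ℕ} {A B : Matrix (Fin d) (Fin d) ℂ} (hA : A.IsHermitian)
    (hB : B.IsHermitian) (hAB : Commute A B) :
    ∃ (U : Matrix (Fin d) (Fin d) ℂ) (a b : Fin d → ℝ), Uᴴ * U = 1 ∧ U * Uᴴ = 1 ∧
      A = udu U a ∧ B = udu U b := by
  have hA' := Matrix.isSymmetric_toEuclideanLin_iff.2 hA
  have hB' := Matrix.isSymmetric_toEuclideanLin_iff.2 hB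
  have hc : Commute (toEuclideanLin A) (toEuclideanLin B) := by
    unfold Commute SemiconjBy
    ext v i
    simp only [Module.End.mul_apply, toLpLin_apply, Matrix.mulVec_mulVec]
    rw [hAB.eq]
  have hV0 := LinearMap.IsSymmetric.directSum_isInternal_of_commute hA' hB' hc
  have hO0 := LinearMap.IsSymmetric.orthogonalFamily_eigenspace_inf_eigenspace hA' hB'
  have hO := hO0.comp (f := fun i : {i : ℂ × ℂ // Module.End.eigenspace (toEuclideanLin A) i.2 ⊓
    Module.End.eigenspace (toEuclideanLin B) i.1 ≠ ⊥} => i.1) Subtype.val_injective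
  have hV := DirectSum.isInternal_ne_bot_iff.2 hV0
  have := hO0.independent.fintypeNeBotOfFiniteDimensional
  have hn : Module.finrank ℂ (EuclideanSpace ℂ (Fin d)) = d := by simp
  let b := hV.subordinateOrthonormalBasis hn hO
  let ix := fun j => hV.subordinateOrthonormalBasisIndex hn j hO
  have hb : ∀ j, b j ∈ _ := fun j => hV.subordinateOrthonormalBasis_subordinate hn j hO
  let U : Matrix (Fin d) (Fin d) ℂ := Matrix.of fun i j => b j i
  have hU : Uᴴ * U = 1 := by
    ext i j
    have := (orthonormal_iff_ite.1 b.orthonormal) i j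
    rw [Matrix.mul_apply, Matrix.one_apply, ← this]
    simp [U, PiLp.inner_apply, mul_comm]
  have hU' : U * Uᴴ = 1 := mul_eq_one_comm.1 hU
  have key : ∀ (C : Matrix (Fin d) (Fin d) ℂ) (hC : C.IsHermitian) (c : Fin d → ℂ),
      (∀ j, toEuclideanLin C (b j) = c j • b j) → C = udu U (fun j => (c j).re) := by
    intro C hC c h
    have h1 : C * U = U * diagonal c := by
      ext i j
      have := congrArg (fun v : EuclideanSpace ℂ (Fin d) => v i) (h j)
      simp only [toLpLin_apply, PiLp.smul_apply, smul_eq_mul] at this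
      rw [Matrix.mul_diagonal, Matrix.mul_apply]
      simp only [U, Matrix.of_apply]
      rw [mul_comm, ← this]
      rfl
    have h2 : diagonal c = Uᴴ * C * U := by
      rw [Matrix.mul_assoc, h1, ← Matrix.mul_assoc, hU, Matrix.one_mul]
    have h3 : (diagonal c).IsHermitian := by
      rw [h2]; exact isHermitian_conjTranspose_mul_mul U hC
    have h4 : ∀ j, ((c j).re : ℂ) = c j := by
      intro j
      have := h3.apply j j
      simp only [diagonal_apply_eq] at this
      exact Complex.conj_eq_iff_re.1 this
    unfold udu
    simp only [h4]
    rw [← h1, Matrix.mul_assoc, hU', Matrix.mul_one]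
  refine ⟨U, fun j => (ix j).1.2.re, fun j => (ix j).1.1.re, hU, hU', ?_, ?_⟩
  · apply key A hA (fun j => (ix j).1.2)
    intro j
    exact Module.End.mem_eigenspace_iff.1 (Submodule.mem_inf.1 (hb j)).1
  · apply key B hB (fun j => (ix j).1.1)
    intro j
    exact Module.End.mem_eigenspace_iff.1 (Submodule.mem_inf.1 (hb j)).2

end ATCM
namespace ATCM
open Finset MeasureTheory Filter Topology

lemma scalar_int {a b : ℝ} (ha : 0 < a) (hb : 0 < b) :
    IntegrableOn (fun t : ℝ => (a - b) ^ 2 / (b + t * a) * ((1 + t) ^ 2)⁻¹) (Set.Ioi 0) ∧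
    ∫ t in Set.Ioi (0 : ℝ), (a - b) ^ 2 / (b + t * a) * ((1 + t) ^ 2)⁻¹
      = a * (Real.log a - Real.log b) - a + b := by
  have hderiv : ∀ x ∈ Set.Ici (0 : ℝ), HasDerivAt
      (fun t : ℝ => a * (Real.log (b + t * a) - Real.log (1 + t)) + (a - b) * (1 + t)⁻¹)
      ((a - b) ^ 2 / (b + x * a) * ((1 + x) ^ 2)⁻¹) x := by
    intro x hx
    have hx0 : 0 ≤ x := hx
    have h1 : 0 < b + x * a := by positivity
    have h2 : 0 < 1 + x := by positivity
    have d1 : HasDerivAt (fun t : ℝ => b + t * a) a x := by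
      simpa using ((hasDerivAt_id x).mul_const a).const_add b
    have d2 : HasDerivAt (fun t : ℝ => 1 + t) 1 x := (hasDerivAt_id x).const_add 1
    have := (((d1.log h1.ne').sub (d2.log h2.ne')).const_mul a).add
      ((d2.inv h2.ne').const_mul (a - b))
    refine this.congr_deriv ?_
    field_simp
    ring
  have hpos : ∀ x ∈ Set.Ioi (0 : ℝ), 0 ≤ (a - b) ^ 2 / (b + x * a) * ((1 + x) ^ 2)⁻¹ := by
    intro x hx
    have hx0 : 0 < x := hx
    positivity
  have hlim : Tendsto
      (fun t : ℝ => a * (Real.log (b + t * a) - Real.log (1 + t)) + (a - b) * (1 + t)⁻¹)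
      atTop (𝓝 (a * Real.log a + (a - b) * 0)) := by
    have hinv : Tendsto (fun t : ℝ => (1 + t)⁻¹) atTop (𝓝 0) :=
      tendsto_inv_atTop_zero.comp (tendsto_atTop_add_const_left _ 1 tendsto_id)
    have hq : Tendsto (fun t : ℝ => a + (b - a) * (1 + t)⁻¹) atTop (𝓝 a) := by
      simpa using (hinv.const_mul (b - a)).const_add a
    have hl := (hq.log ha.ne').const_mul a
    refine Tendsto.add (hl.congr' ?_) (hinv.const_mul _)
    filter_upwards [eventually_ge_atTop (0 : ℝ)] with t ht
    have h1 : 0 < b + t * a := by positivity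
    have h2 : 0 < 1 + t := by positivity
    have h3 : a + (b - a) * (1 + t)⁻¹ = (b + t * a) / (1 + t) := by
      field_simp
      ring
    rw [← Real.log_div h1.ne' h2.ne', h3]
  refine ⟨integrableOn_Ioi_deriv_of_nonneg'  hderiv hpos hlim, ?_⟩
  rw [integral_Ioi_of_hasDerivAt_of_nonneg' hderiv hpos hlim]
  simp
  ring

lemma trace_udu_mul {d : ℕ} (U V : Matrix (Fin d) (Fin d) ℂ) (f g : Fin d → ℝ) :
    ((udu U f * udu V g).trace).re
      = ∑ i, ∑ j, Complex.normSq ((Uᴴ * V) i j) * (f i * g j) := by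
  have h : (udu U f * udu V g).trace
      = ((diagonal (fun i => (f i : ℂ))) * (Uᴴ * V) * (diagonal (fun i => (g i : ℂ)))
          * (Uᴴ * V)ᴴ).trace := by
    unfold udu
    rw [conjTranspose_mul, conjTranspose_conjTranspose]
    simp only [Matrix.mul_assoc]
    rw [Matrix.trace_mul_comm]
    simp only [Matrix.mul_assoc]
  rw [h, Matrix.trace, Complex.re_sum]
  refine sum_congr rfl fun i _ => ?_
  rw [Matrix.diag_apply, Matrix.mul_apply, Complex.re_sum]
  refine sum_congr rfl fun j _ => ?_
  rw [Matrix.mul_diagonal, Matrix.diagonal_mul, conjTranspose_apply]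
  simp only [Complex.mul_re, Complex.mul_im, Complex.ofReal_re, Complex.ofReal_im,
    Complex.star_def, Complex.conj_re, Complex.conj_im, Complex.normSq_apply]
  ring

lemma DLin_udu {d : ℕ} {U V : Matrix (Fin d) (Fin d) ℂ} (hU : Uᴴ * U = 1) (hU' : U * Uᴴ = 1)
    (hV : Vᴴ * V = 1) (hV' : V * Vᴴ = 1) (a b : Fin d → ℝ) :
    DLin (udu U a) (udu V b) = ∑ i, ∑ j, Complex.normSq ((Uᴴ * V) i j) *
      (a i * (Real.log (a i) - Real.log (b j)) - a i + b j) := by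
  have h1V : udu V (fun _ => 1) = 1 := by rw [udu_const hV']; simp
  have h1U : udu U (fun _ => 1) = 1 := by rw [udu_const hU']; simp
  have t1 : ((udu U a * udu U (fun i => Real.log (a i))).trace).re
      = ∑ i, ∑ j, Complex.normSq ((Uᴴ * V) i j) * (a i * Real.log (a i) * 1) := by
    rw [udu_mul hU, ← trace_udu_mul, h1V, Matrix.mul_one]
  have t2 := trace_udu_mul U V a (fun j => Real.log (b j))
  have t3 : ((udu U a).trace).re = ∑ i, ∑ j, Complex.normSq ((Uᴴ * V) i j) * (a i * 1) := by
    rw [← trace_udu_mul, h1V, Matrix.mul_one]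
  have t4 : ((udu V b).trace).re = ∑ i, ∑ j, Complex.normSq ((Uᴴ * V) i j) * (1 * b j) := by
    rw [← trace_udu_mul U V (fun _ => 1) b, h1U, Matrix.one_mul]
  unfold DLin matLog
  rw [cfc_udu hU hU', cfc_udu hV hV', Matrix.mul_sub, Matrix.trace_sub, Complex.sub_re,
    t1, t2, t3, t4]
  simp only [← sum_sub_distrib, ← sum_add_distrib]
  refine sum_congr rfl fun i _ => sum_congr rfl fun j _ => ?_
  ring

/-- the variational functional -/
def Qf {d : ℕ} (t : ℝ) (A B Z : Matrix (Fin d) (Fin d) ℂ) : ℝ :=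
  2 * (((A - B) * Zᴴ).trace).re - ((Z * B * Zᴴ).trace).re - t * ((Zᴴ * A * Z).trace).re

def ht {d : ℕ} (U V : Matrix (Fin d) (Fin d) ℂ) (a b : Fin d → ℝ) (t : ℝ) : ℝ :=
  ∑ i, ∑ j, Complex.normSq ((Uᴴ * V) i j) * ((a i - b j) ^ 2 / (b j + t * a i))

lemma Qf_udu {d : ℕ} {U V : Matrix (Fin d) (Fin d) ℂ} (hU : Uᴴ * U = 1) (hU' : U * Uᴴ = 1)
    (hV : Vᴴ * V = 1) (hV' : V * Vᴴ = 1) (a b : Fin d → ℝ) (t : ℝ)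
    (z : Matrix (Fin d) (Fin d) ℂ) :
    Qf t (udu U a) (udu V b) (U * z * Vᴴ) = ∑ i, ∑ j,
      (2 * ((a i - b j) * (((Uᴴ * V) i j) * star (z i j)).re)
        - (b j + t * a i) * Complex.normSq (z i j)) := by
  have e1 : ((udu U a - udu V b) * (U * z * Vᴴ)ᴴ).trace
      = ((diagonal (fun i => (a i : ℂ)) * (Uᴴ * V) - (Uᴴ * V) * diagonal (fun i => (b i : ℂ)))
          * zᴴ).trace := by
    have : ((diagonal (fun i => (a i : ℂ)) * (Uᴴ * V) - (Uᴴ * V) * diagonal (fun i => (b i : ℂ)))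
          * zᴴ) = Uᴴ * ((udu U a - udu V b) * V * zᴴ) := by
      unfold udu
      simp only [Matrix.sub_mul, Matrix.mul_sub, ← Matrix.mul_assoc, hU, Matrix.one_mul]
      simp only [Matrix.mul_assoc, hV, Matrix.mul_one]
    rw [this, Matrix.trace_mul_comm Uᴴ]
    simp only [conjTranspose_mul, conjTranspose_conjTranspose, Matrix.mul_assoc]
  have e2 : ((U * z * Vᴴ) * udu V b * (U * z * Vᴴ)ᴴ).trace
      = (z * diagonal (fun i => (b i : ℂ)) * zᴴ).trace := by
    have : (U * z * Vᴴ) * udu V b * (U * z * Vᴴ)ᴴ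
        = U * (z * (Vᴴ * V) * diagonal (fun i => (b i : ℂ)) * (Vᴴ * V) * zᴴ * Uᴴ) := by
      unfold udu
      simp only [conjTranspose_mul, conjTranspose_conjTranspose, Matrix.mul_assoc]
    rw [this, Matrix.trace_mul_comm, hV, Matrix.mul_assoc _ Uᴴ, hU]
    simp
  have e3 : ((U * z * Vᴴ)ᴴ * udu U a * (U * z * Vᴴ)).trace
      = (zᴴ * diagonal (fun i => (a i : ℂ)) * z).trace := by
    have : (U * z * Vᴴ)ᴴ * udu U a * (U * z * Vᴴ)
        = V * (zᴴ * (Uᴴ * U) * diagonal (fun i => (a i : ℂ)) * (Uᴴ * U) * z * Vᴴ) := by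
      unfold udu
      simp only [conjTranspose_mul, conjTranspose_conjTranspose, Matrix.mul_assoc]
    rw [this, Matrix.trace_mul_comm, hU, Matrix.mul_assoc _ Vᴴ, hV]
    simp
  have f1 : (((diagonal (fun i => (a i : ℂ)) * (Uᴴ * V) - (Uᴴ * V) * diagonal (fun i => (b i : ℂ)))
          * zᴴ).trace).re = ∑ i, ∑ j, (a i - b j) * (((Uᴴ * V) i j) * star (z i j)).re := by
    rw [Matrix.trace, Complex.re_sum]
    refine sum_congr rfl fun i _ => ?_
    rw [Matrix.diag_apply, Matrix.mul_apply, Complex.re_sum]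
    refine sum_congr rfl fun j _ => ?_
    rw [Matrix.sub_apply, Matrix.mul_diagonal, Matrix.diagonal_mul, conjTranspose_apply]
    simp only [Complex.mul_re, Complex.mul_im, Complex.ofReal_re, Complex.ofReal_im,
      Complex.sub_re, Complex.sub_im]
    ring
  have f2 : ((z * diagonal (fun i => (b i : ℂ)) * zᴴ).trace).re
      = ∑ i, ∑ j, b j * Complex.normSq (z i j) := by
    rw [Matrix.trace, Complex.re_sum]
    refine sum_congr rfl fun i _ => ?_
    rw [Matrix.diag_apply, Matrix.mul_apply, Complex.re_sum]
    refine sum_congr rfl fun j _ => ?_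
    rw [Matrix.mul_diagonal, conjTranspose_apply]
    simp only [Complex.mul_re, Complex.mul_im, Complex.ofReal_re, Complex.ofReal_im,
      Complex.star_def, Complex.conj_re, Complex.conj_im, Complex.normSq_apply]
    ring
  have f3 : ((zᴴ * diagonal (fun i => (a i : ℂ)) * z).trace).re
      = ∑ i, ∑ j, a i * Complex.normSq (z i j) := by
    rw [Matrix.trace, Complex.re_sum, sum_comm]
    refine sum_congr rfl fun i _ => ?_
    rw [Matrix.diag_apply, Matrix.mul_apply, Complex.re_sum]
    refine sum_congr rfl fun j _ => ?_
    rw [Matrix.mul_diagonal, conjTranspose_apply]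
    simp only [Complex.mul_re, Complex.mul_im, Complex.ofReal_re, Complex.ofReal_im,
      Complex.star_def, Complex.conj_re, Complex.conj_im, Complex.normSq_apply]
    ring
  unfold Qf
  rw [e1, e2, e3, f1, f2, f3]
  simp only [mul_sum, ← sum_sub_distrib]
  refine sum_congr rfl fun i _ => sum_congr rfl fun j _ => ?_
  ring

lemma sc_bound (w z : ℂ) (r c : ℝ) (hc : 0 < c) :
    2 * (r * (w * star z).re) - c * Complex.normSq z ≤ Complex.normSq w * (r ^ 2 / c) := by
  have h : 0 ≤ (r * w.re - c * z.re) ^ 2 + (r * w.im - c * z.im) ^ 2 := by positivity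
  rw [← mul_div_assoc, le_div_iff₀ hc]
  simp only [Complex.mul_re, Complex.star_def, Complex.conj_re, Complex.conj_im,
    Complex.normSq_apply]
  nlinarith

lemma sc_eq (w : ℂ) (r c : ℝ) (hc : 0 < c) :
    2 * (r * (w * star (((r / c : ℝ) : ℂ) * w)).re)
      - c * Complex.normSq (((r / c : ℝ) : ℂ) * w) = Complex.normSq w * (r ^ 2 / c) := by
  simp only [Complex.mul_re, Complex.mul_im, Complex.star_def, Complex.conj_re, Complex.conj_im,
    Complex.normSq_apply, Complex.ofReal_re, Complex.ofReal_im]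
  field_simp
  ring

lemma Qf_le {d : ℕ} {U V : Matrix (Fin d) (Fin d) ℂ} (hU : Uᴴ * U = 1) (hU' : U * Uᴴ = 1)
    (hV : Vᴴ * V = 1) (hV' : V * Vᴴ = 1) {a b : Fin d → ℝ} (ha : ∀ i, 0 < a i)
    (hb : ∀ i, 0 < b i) {t : ℝ} (h0 : 0 < t) (Z : Matrix (Fin d) (Fin d) ℂ) :
    Qf t (udu U a) (udu V b) Z ≤ ht U V a b t := by
  have hZ : Z = U * (Uᴴ * Z * V) * Vᴴ := by
    calc Z = (U * Uᴴ) * Z * (V * Vᴴ) := by rw [hU', hV']; simp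
      _ = _ := by simp only [Matrix.mul_assoc]
  rw [hZ, Qf_udu hU hU' hV hV']
  refine sum_le_sum fun i _ => sum_le_sum fun j _ => ?_
  have := ha i
  have := hb j
  exact sc_bound _ _ _ _ (by positivity)

lemma Qf_attain {d : ℕ} {U V : Matrix (Fin d) (Fin d) ℂ} (hU : Uᴴ * U = 1) (hU' : U * Uᴴ = 1)
    (hV : Vᴴ * V = 1) (hV' : V * Vᴴ = 1) {a b : Fin d → ℝ} (ha : ∀ i, 0 < a i)
    (hb : ∀ i, 0 < b i) {t : ℝ} (h0 : 0 < t) :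
    ∃ Z, Qf t (udu U a) (udu V b) Z = ht U V a b t := by
  refine ⟨U * (Matrix.of fun i j => (((a i - b j) / (b j + t * a i) : ℝ) : ℂ) * (Uᴴ * V) i j)
    * Vᴴ, ?_⟩
  rw [Qf_udu hU hU' hV hV']
  refine sum_congr rfl fun i _ => sum_congr rfl fun j _ => ?_
  have := ha i
  have := hb j
  exact sc_eq _ _ _ (by positivity)

lemma DLin_integral {d : ℕ} {U V : Matrix (Fin d) (Fin d) ℂ} (hU : Uᴴ * U = 1) (hU' : U * Uᴴ = 1)
    (hV : Vᴴ * V = 1) (hV' : V * Vᴴ = 1) {a b : Fin d → ℝ} (ha : ∀ i, 0 < a i)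
    (hb : ∀ i, 0 < b i) :
    IntegrableOn (fun t => ht U V a b t * ((1 + t) ^ 2)⁻¹) (Set.Ioi 0) ∧
    DLin (udu U a) (udu V b) = ∫ t in Set.Ioi (0 : ℝ), ht U V a b t * ((1 + t) ^ 2)⁻¹ := by
  have e : (fun t => ht U V a b t * ((1 + t) ^ 2)⁻¹) = fun t : ℝ => ∑ i, ∑ j,
      Complex.normSq ((Uᴴ * V) i j) * ((a i - b j) ^ 2 / (b j + t * a i) * ((1 + t) ^ 2)⁻¹) := by
    ext t
    simp only [ht, sum_mul]
    refine sum_congr rfl fun i _ => sum_congr rfl fun j _ => ?_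
    ring
  have hi : ∀ i j, Integrable (fun t : ℝ => Complex.normSq ((Uᴴ * V) i j) *
      ((a i - b j) ^ 2 / (b j + t * a i) * ((1 + t) ^ 2)⁻¹)) (volume.restrict (Set.Ioi 0)) :=
    fun i j => Integrable.const_mul (scalar_int (ha i) (hb j)).1 _
  constructor
  · rw [e]
    exact integrable_finsetSum _ fun i _ => integrable_finsetSum _ fun j _ => hi i j
  · rw [e, integral_finsetSum _ fun i _ => integrable_finsetSum _ fun j _ => hi i j,
      DLin_udu hU hU' hV hV']
    refine sum_congr rfl fun i _ => ?_
    rw [integral_finsetSum _ fun j _ => hi i j]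
    refine sum_congr rfl fun j _ => ?_
    rw [integral_const_mul, (scalar_int (ha i) (hb j)).2]

lemma DLin_nonneg {d : ℕ} {A B : Matrix (Fin d) (Fin d) ℂ} (hA : A.PosDef) (hB : B.PosDef) :
    0 ≤ DLin A B := by
  obtain ⟨U, hU, hU', eA⟩ := exists_udu hA.1
  obtain ⟨V, hV, hV', eB⟩ := exists_udu hB.1
  rw [eA, eB, (DLin_integral hU hU' hV hV' hA.eigenvalues_pos hB.eigenvalues_pos).2]
  refine setIntegral_nonneg measurableSet_Ioi fun t (h : 0 < t) => ?_
  refine mul_nonneg (sum_nonneg fun i _ => sum_nonneg fun j _ => ?_) (by positivity)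
  have := hA.eigenvalues_pos i
  have := hB.eigenvalues_pos j
  exact mul_nonneg (Complex.normSq_nonneg _) (by positivity)

lemma trace_mul_psd {d : ℕ} {A B : Matrix (Fin d) (Fin d) ℂ} (hA : A.PosSemidef)
    (hB : B.PosSemidef) : 0 ≤ ((A * B).trace).re := by
  obtain ⟨U, hU, hU', eA⟩ := exists_udu hA.1
  obtain ⟨V, hV, hV', eB⟩ := exists_udu hB.1
  rw [eA, eB, trace_udu_mul]
  refine sum_nonneg fun i _ => sum_nonneg fun j _ => ?_
  exact mul_nonneg (Complex.normSq_nonneg _)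
    (mul_nonneg (hA.eigenvalues_nonneg i) (hB.eigenvalues_nonneg j))

/-- Data processing for a single Kraus operator. -/
lemma DLin_dpi {d : ℕ} {A B K : Matrix (Fin d) (Fin d) ℂ} (hA : A.PosDef) (hB : B.PosDef)
    (hA' : (K * A * Kᴴ).PosDef) (hB' : (K * B * Kᴴ).PosDef) {k : ℝ} (hk : 0 < k)
    (hK : (k • (1 : Matrix (Fin d) (Fin d) ℂ) - K * Kᴴ).PosSemidef) :
    DLin (K * A * Kᴴ) (K * B * Kᴴ) ≤ k * DLin A B := by
  obtain ⟨U, hU, hU', eA⟩ := exists_udu hA.1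
  obtain ⟨V, hV, hV', eB⟩ := exists_udu hB.1
  obtain ⟨U1, hU1, hU1', eA1⟩ := exists_udu hA'.1
  obtain ⟨V1, hV1, hV1', eB1⟩ := exists_udu hB'.1
  have I := DLin_integral hU hU' hV hV' hA.eigenvalues_pos hB.eigenvalues_pos
  have I1 := DLin_integral hU1 hU1' hV1 hV1' hA'.eigenvalues_pos hB'.eigenvalues_pos
  rw [← eA, ← eB] at I
  rw [← eA1, ← eB1] at I1
  rw [I.2, I1.2, ← integral_const_mul]
  refine setIntegral_mono_on I1.1 (Integrable.const_mul I.1 _) measurableSet_Ioi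
    fun t (h0 : 0 < t) => ?_
  rw [← mul_assoc]
  refine mul_le_mul_of_nonneg_right ?_ (by positivity)
  obtain ⟨Z, hZ⟩ := Qf_attain hU1 hU1' hV1 hV1' hA'.eigenvalues_pos hB'.eigenvalues_pos h0
  have hle := Qf_le hU hU' hV hV' hA.eigenvalues_pos hB.eigenvalues_pos h0
    (k⁻¹ • (Kᴴ * Z * K))
  rw [← eA1, ← eB1] at hZ
  rw [← eA, ← eB] at hle
  rw [← hZ]
  refine le_trans ?_ (mul_le_mul_of_nonneg_left hle hk.le)
  have g2 := trace_mul_psd hK (hB'.posSemidef.mul_mul_conjTranspose_same Z)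
  have g3 := trace_mul_psd hK (hA'.posSemidef.conjTranspose_mul_mul_same Z)
  rw [Matrix.sub_mul, Matrix.trace_sub, Complex.sub_re, Matrix.smul_mul, Matrix.trace_smul,
    Complex.smul_re, Matrix.one_mul, smul_eq_mul] at g2 g3
  have c1 : ((K * A * Kᴴ - K * B * Kᴴ) * Zᴴ).trace = ((A - B) * (Kᴴ * Z * K)ᴴ).trace := by
    rw [← Matrix.sub_mul, ← Matrix.mul_sub]
    simp only [conjTranspose_mul, conjTranspose_conjTranspose, Matrix.mul_assoc]
    rw [Matrix.trace_mul_comm]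
    simp only [Matrix.mul_assoc]
  have c2 : (K * Kᴴ * (Z * (K * B * Kᴴ) * Zᴴ)).trace
      = ((Kᴴ * Z * K) * B * (Kᴴ * Z * K)ᴴ).trace := by
    simp only [conjTranspose_mul, conjTranspose_conjTranspose, Matrix.mul_assoc]
    rw [Matrix.trace_mul_comm]
    simp only [Matrix.mul_assoc]
  have c3 : (K * Kᴴ * (Zᴴ * (K * A * Kᴴ) * Z)).trace
      = ((Kᴴ * Z * K)ᴴ * A * (Kᴴ * Z * K)).trace := by
    simp only [conjTranspose_mul, conjTranspose_conjTranspose, Matrix.mul_assoc]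
    rw [Matrix.trace_mul_comm]
    simp only [Matrix.mul_assoc]
  rw [c2] at g2
  rw [c3] at g3
  unfold Qf
  rw [c1]
  simp only [conjTranspose_smul, Matrix.smul_mul, Matrix.mul_smul, Matrix.trace_smul,
    Complex.smul_re, smul_eq_mul, star_trivial]
  generalize (((A - B) * (Kᴴ * Z * K)ᴴ).trace).re = x at *
  generalize ((Kᴴ * Z * K * B * (Kᴴ * Z * K)ᴴ).trace).re = y at *
  generalize (((Kᴴ * Z * K)ᴴ * A * (Kᴴ * Z * K)).trace).re = w at *
  generalize ((Z * (K * B * Kᴴ) * Zᴴ).trace).re = y' at *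
  generalize ((Zᴴ * (K * A * Kᴴ) * Z).trace).re = w' at *
  have e : k * (2 * (k⁻¹ * x) - k⁻¹ * (k⁻¹ * y) - t * (k⁻¹ * (k⁻¹ * w)))
      = 2 * x - k⁻¹ * y - t * (k⁻¹ * w) := by
    field_simp
  rw [e]
  have g2' : k⁻¹ * y ≤ y' := by rw [inv_mul_le_iff₀ hk]; linarith
  have g3' : k⁻¹ * w ≤ w' := by rw [inv_mul_le_iff₀ hk]; linarith
  have := mul_le_mul_of_nonneg_left g3' h0.le
  linarith

end ATCM
namespace ATCM
open Finset

lemma psd_of_quad {d : ℕ} {M : Matrix (Fin d) (Fin d) ℂ}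
    (h : ∀ v : Fin d → ℂ, 0 ≤ star v ⬝ᵥ M *ᵥ v) : M.PosSemidef := by
  rw [← Matrix.isPositive_toEuclideanLin_iff, LinearMap.isPositive_iff_complex]
  intro x
  have hx := h x.ofLp
  have e : inner ℂ (toEuclideanLin M x) x = star (star x.ofLp ⬝ᵥ M *ᵥ x.ofLp) := by
    rw [← Matrix.star_dotProduct_star]
    simp [PiLp.inner_apply, dotProduct, toLpLin_apply, mul_comm]
  rw [e, (IsSelfAdjoint.of_nonneg hx).star_eq]
  rw [Complex.nonneg_iff] at hx
  constructor
  · apply Complex.ext <;> simp [← hx.2]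
  · simpa using hx.1

lemma trace_mul_psd' {d : ℕ} {A B : Matrix (Fin d) (Fin d) ℂ} (hA : A.PosSemidef)
    (hB : B.PosSemidef) : 0 ≤ (A * B).trace := by
  rw [Complex.nonneg_iff]
  refine ⟨trace_mul_psd hA hB, ?_⟩
  have : star ((A * B).trace) = (A * B).trace := by
    rw [← Matrix.trace_conjTranspose, conjTranspose_mul, hA.1.eq, hB.1.eq, Matrix.trace_mul_comm]
  exact (Complex.conj_eq_iff_im.1 this).symm

lemma quad_eq_trace {d : ℕ} (M : Matrix (Fin d) (Fin d) ℂ) (v : Fin d → ℂ) :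
    star v ⬝ᵥ M *ᵥ v = (M * vecMulVec v (star v)).trace := by
  rw [Matrix.mul_vecMulVec, Matrix.trace_vecMulVec, dotProduct_comm]

lemma dual_pos {d : ℕ} {E Es : Matrix (Fin d) (Fin d) ℂ →ₗ[ℂ] Matrix (Fin d) (Fin d) ℂ}
    (hpos : ∀ X : Matrix (Fin d) (Fin d) ℂ, X.PosSemidef → (E X).PosSemidef)
    (hs : ∀ X Y, (Es X * Y).trace = (X * E Y).trace)
    {Y : Matrix (Fin d) (Fin d) ℂ} (hY : Y.PosSemidef) : (Es Y).PosSemidef := by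
  apply psd_of_quad
  intro v
  rw [quad_eq_trace, hs]
  exact trace_mul_psd' hY (hpos _ (posSemidef_vecMulVec_self_star v))

lemma udu_psd {d : ℕ} (U : Matrix (Fin d) (Fin d) ℂ) {a : Fin d → ℝ} (ha : ∀ i, 0 ≤ a i) :
    (udu U a).PosSemidef := by
  unfold udu
  apply PosSemidef.mul_mul_conjTranspose_same
  apply PosSemidef.diagonal
  intro i
  simpa using ha i

lemma udu_sum {d : ℕ} (U : Matrix (Fin d) (Fin d) ℂ) (a : Fin d → ℝ) :
    udu U a = ∑ i, (a i : ℂ) • udu U (Pi.single i 1) := by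
  unfold udu
  have hsm : ∀ i, (a i : ℂ) • (U * diagonal (fun j => ((Pi.single i 1 : Fin d → ℝ) j : ℂ)) * Uᴴ)
      = U * ((a i : ℂ) • diagonal (fun j => ((Pi.single i 1 : Fin d → ℝ) j : ℂ))) * Uᴴ := by
    intro i
    rw [Matrix.mul_smul, Matrix.smul_mul]
  simp only [hsm]
  rw [← Matrix.sum_mul, ← Matrix.mul_sum]
  congr 2
  ext i j
  rw [Matrix.sum_apply]
  by_cases h : i = j
  · subst h
    rw [Finset.sum_eq_single i]
    · simp
    · intro j _ hj
      simp [Ne.symm hj]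
    · simp
  · simp [h]

lemma kadison {d : ℕ} {E : Matrix (Fin d) (Fin d) ℂ →ₗ[ℂ] Matrix (Fin d) (Fin d) ℂ}
    (hpos : ∀ X : Matrix (Fin d) (Fin d) ℂ, X.PosSemidef → (E X).PosSemidef)
    (hone : E 1 = 1) {h : Matrix (Fin d) (Fin d) ℂ} (hh : h.IsHermitian) :
    (E h).IsHermitian ∧ (E (h * h) - E h * E h).PosSemidef := by
  obtain ⟨U, hU, hU', e⟩ := exists_udu hh
  generalize hh.eigenvalues = l at e
  let Q := fun i => E (udu U (Pi.single i 1))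
  have hQ : ∀ i, (Q i).PosSemidef := fun i => hpos _ (udu_psd U (fun j => by
    by_cases hj : j = i <;> simp [Pi.single_apply, hj]))
  have eE : ∀ f : Fin d → ℝ, E (udu U f) = ∑ i, (f i : ℂ) • Q i := by
    intro f
    rw [udu_sum, map_sum]
    simp [Q]
  have e1 : ∑ i, Q i = 1 := by
    have := eE (fun _ => 1)
    rw [udu_const hU', one_smul, hone] at this
    simpa using this.symm
  have eB : E h = ∑ i, (l i : ℂ) • Q i := by rw [e, eE]
  have eBB : E (h * h) = ∑ i, ((l i * l i : ℝ) : ℂ) • Q i := by rw [e, udu_mul hU, eE]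
  have hB : (E h).IsHermitian := by
    rw [eB, Matrix.IsHermitian, conjTranspose_sum]
    refine sum_congr rfl fun i _ => ?_
    rw [conjTranspose_smul, (hQ i).1.eq]
    simp
  refine ⟨hB, ?_⟩
  have key : E (h * h) - E h * E h
      = ∑ i, ((l i : ℂ) • 1 - E h) * Q i * ((l i : ℂ) • 1 - E h)ᴴ := by
    have hc : ∀ i, ((l i : ℂ) • (1 : Matrix (Fin d) (Fin d) ℂ) - E h)ᴴ = (l i : ℂ) • 1 - E h := by
      intro i
      rw [conjTranspose_sub, hB.eq, conjTranspose_smul]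
      simp
    have ht : ∀ i, ((l i : ℂ) • 1 - E h) * Q i * ((l i : ℂ) • 1 - E h)ᴴ
        = ((l i * l i : ℝ) : ℂ) • Q i - E h * ((l i : ℂ) • Q i) - ((l i : ℂ) • Q i) * E h
          + E h * Q i * E h := by
      intro i
      rw [hc]
      simp only [Matrix.sub_mul, Matrix.mul_sub, Matrix.smul_mul, Matrix.mul_smul, Matrix.one_mul,
        Matrix.mul_one, Complex.ofReal_mul, smul_sub, smul_smul]
      abel
    simp only [ht]
    rw [sum_add_distrib, sum_sub_distrib, sum_sub_distrib, ← Matrix.mul_sum, ← Matrix.sum_mul,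
      ← eB, ← eBB, ← Matrix.sum_mul, ← Matrix.mul_sum, e1, Matrix.mul_one]
    abel
  rw [key]
  exact posSemidef_sum _ fun i _ => (hQ i).mul_mul_conjTranspose_same _

lemma psd_zero {d : ℕ} {J G : Matrix (Fin d) (Fin d) ℂ} (hJ : J.IsHermitian)
    (h : ∀ t : ℝ, ((t : ℂ) • J + ((t * t : ℝ) : ℂ) • G).PosSemidef) : J = 0 := by
  have hJ0 : ∀ v : Fin d → ℂ, star v ⬝ᵥ J *ᵥ v = 0 := by
    intro v
    have hre : ∀ t : ℝ, 0 ≤ t * (star v ⬝ᵥ J *ᵥ v).re + t * t * (star v ⬝ᵥ G *ᵥ v).re := by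
      intro t
      have := (h t).dotProduct_mulVec_nonneg v
      rw [Matrix.add_mulVec, Matrix.smul_mulVec, Matrix.smul_mulVec, dotProduct_add,
        dotProduct_smul, dotProduct_smul, Complex.nonneg_iff] at this
      have h1 := this.1
      simpa only [Complex.add_re, smul_eq_mul, Complex.re_ofReal_mul] using h1
    have him : (star v ⬝ᵥ J *ᵥ v).im = 0 := by
      have : star (star v ⬝ᵥ J *ᵥ v) = star v ⬝ᵥ J *ᵥ v := by
        rw [quad_eq_trace, ← Matrix.trace_conjTranspose, conjTranspose_mul, hJ.eq,
          (posSemidef_vecMulVec_self_star v).1.eq, Matrix.trace_mul_comm]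
      exact Complex.conj_eq_iff_im.1 this
    generalize (star v ⬝ᵥ G *ᵥ v).re = g at hre
    apply Complex.ext _ him
    generalize (star v ⬝ᵥ J *ᵥ v).re = j at hre
    by_contra hj
    simp only [Complex.zero_re] at hj
    have hg : 0 < 1 + |g| := by positivity
    have := hre (-j / (1 + |g|))
    have e : -j / (1 + |g|) * j + -j / (1 + |g|) * (-j / (1 + |g|)) * g
        = -(j ^ 2 * (1 + |g| - g)) / (1 + |g|) ^ 2 := by
      field_simp
      ring
    rw [e] at this
    have hp : 0 < j ^ 2 * (1 + |g| - g) := by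
      have := le_abs_self g
      have : 0 < 1 + |g| - g := by linarith
      positivity
    have : -(j ^ 2 * (1 + |g| - g)) / (1 + |g|) ^ 2 < 0 := by
      apply div_neg_of_neg_of_pos
      · linarith
      · positivity
    linarith
  have hP : J.PosSemidef := psd_of_quad fun v => (hJ0 v).ge
  ext i j
  have := (hP.dotProduct_mulVec_zero_iff (Pi.single j 1)).1 (hJ0 _)
  have := congrFun this i
  simpa using this

lemma jordan {d : ℕ} {N : StarSubalgebra ℂ (Matrix (Fin d) (Fin d) ℂ)}
    {E : Matrix (Fin d) (Fin d) ℂ →ₗ[ℂ] Matrix (Fin d) (Fin d) ℂ}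
    (hpos : ∀ X : Matrix (Fin d) (Fin d) ℂ, X.PosSemidef → (E X).PosSemidef)
    (hone : E 1 = 1) (hid : ∀ X ∈ N, E X = X)
    {a x : Matrix (Fin d) (Fin d) ℂ} (ha : a.IsHermitian) (haN : a ∈ N) (hx : x.IsHermitian) :
    E (a * x + x * a) = a * E x + E x * a := by
  rw [← sub_eq_zero]
  have hEx := (kadison hpos hone hx).1
  apply psd_zero (G := E (x * x) - E x * E x)
  · have h1 : (a * x + x * a).IsHermitian := by
      rw [Matrix.IsHermitian, conjTranspose_add, conjTranspose_mul, conjTranspose_mul, ha.eq, hx.eq,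
        add_comm]
    have h2 : (a * E x + E x * a).IsHermitian := by
      rw [Matrix.IsHermitian, conjTranspose_add, conjTranspose_mul, conjTranspose_mul, ha.eq,
        hEx.eq, add_comm]
    exact (kadison hpos hone h1).1.sub h2
  · intro t
    have hh : (a + (t : ℂ) • x).IsHermitian := by
      rw [Matrix.IsHermitian, conjTranspose_add, conjTranspose_smul, ha.eq, hx.eq]
      simp
    have := (kadison hpos hone hh).2
    have haa : E (a * a) = a * a := hid _ (mul_mem haN haN)
    convert this using 1
    simp only [Matrix.add_mul, Matrix.mul_add, Matrix.smul_mul, Matrix.mul_smul, map_add, map_smul,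
      hid a haN, haa, Complex.ofReal_mul, mul_smul, smul_sub, smul_add]
    abel

lemma comm_of_jordan_pos {d : ℕ} {N : StarSubalgebra ℂ (Matrix (Fin d) (Fin d) ℂ)}
    {T : Matrix (Fin d) (Fin d) ℂ}
    (h : ∀ b ∈ N, b.PosSemidef → (T * b + b * T).PosSemidef)
    {y : Matrix (Fin d) (Fin d) ℂ} (hy : y.IsHermitian) (hyN : y ∈ N) : Commute T y := by
  obtain ⟨U, hU, hU', e⟩ := exists_udu hy
  generalize hy.eigenvalues = l at e
  have key : ∀ i k, (Uᴴ * T * U) i k * (l k : ℂ) = (l i : ℂ) * (Uᴴ * T * U) i k := by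
    intro i k
    have hbe : (y - (l k : ℂ) • 1) * (y - (l k : ℂ) • 1) = udu U (fun i => (l i - l k) ^ 2) := by
      have : y - (l k : ℂ) • 1 = udu U (fun i => l i - l k) := by
        have h1 := udu_add U l (fun _ => - l k)
        rw [udu_const hU', ← e] at h1
        simp only [← sub_eq_add_neg] at h1
        rw [← h1]
        simp [sub_eq_add_neg]
      rw [this, udu_mul hU]
      simp only [pow_two]
    have hmem : y - (l k : ℂ) • 1 ∈ N := sub_mem hyN (N.smul_mem (one_mem N) _)
    have hP := h _ (mul_mem hmem hmem) (by rw [hbe]; exact udu_psd U fun i => by positivity)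
    have hP2 := hP.conjTranspose_mul_mul_same U
    have eP : Uᴴ * (T * udu U (fun i => (l i - l k) ^ 2) + udu U (fun i => (l i - l k) ^ 2) * T) * U
        = (Uᴴ * T * U) * diagonal (fun i => (((l i - l k) ^ 2 : ℝ) : ℂ))
          + diagonal (fun i => (((l i - l k) ^ 2 : ℝ) : ℂ)) * (Uᴴ * T * U) := by
      unfold udu
      rw [Matrix.mul_add, Matrix.add_mul]
      congr 1
      · simp only [Matrix.mul_assoc, hU, Matrix.mul_one]
      · simp only [← Matrix.mul_assoc, hU, Matrix.one_mul]
    rw [hbe, eP] at hP2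
    have hz := (hP2.dotProduct_mulVec_zero_iff (Pi.single k 1)).1 (by
      simp [Matrix.mul_diagonal, Matrix.diagonal_mul])
    have hz' := congrFun hz i
    simp only [Matrix.mulVec_single_one, Matrix.col_apply, Matrix.add_apply, Matrix.mul_diagonal,
      Matrix.diagonal_mul, Pi.zero_apply, sub_self] at hz'
    have hz2 : (((l i - l k) ^ 2 : ℝ) : ℂ) * (Uᴴ * T * U) i k = 0 := by simpa using hz'
    rcases mul_eq_zero.1 hz2 with h0 | h0
    · have : l i = l k := by
        have : (l i - l k) ^ 2 = 0 := by exact_mod_cast h0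
        have := pow_eq_zero_iff (two_ne_zero) |>.1 this
        linarith
      rw [this, mul_comm]
    · rw [h0]; simp
  have key2 : (Uᴴ * T * U) * diagonal (fun i => (l i : ℂ))
      = diagonal (fun i => (l i : ℂ)) * (Uᴴ * T * U) := by
    ext i k
    rw [Matrix.mul_diagonal, Matrix.diagonal_mul, key]
  have key3 : U * ((Uᴴ * T * U) * diagonal (fun i => (l i : ℂ))) * Uᴴ
      = U * (diagonal (fun i => (l i : ℂ)) * (Uᴴ * T * U)) * Uᴴ := by rw [key2]
  have l1 : U * ((Uᴴ * T * U) * diagonal (fun i => (l i : ℂ))) * Uᴴ = T * y := by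
    rw [e]; unfold udu
    simp only [← Matrix.mul_assoc, hU', Matrix.one_mul]
  have l2 : U * (diagonal (fun i => (l i : ℂ)) * (Uᴴ * T * U)) * Uᴴ = y * T := by
    rw [e]; unfold udu
    simp only [Matrix.mul_assoc, hU', Matrix.mul_one]
  rw [l1, l2] at key3
  exact key3

/-- Structure of the preadjoint: `Es Y = τ * E0 Y` with `τ` in the commutant. -/
lemma struct {d : ℕ} {N : StarSubalgebra ℂ (Matrix (Fin d) (Fin d) ℂ)}
    {σ : Matrix (Fin d) (Fin d) ℂ} (hσ : σ.PosDef)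
    {E Es E0 : Matrix (Fin d) (Fin d) ℂ →ₗ[ℂ] Matrix (Fin d) (Fin d) ℂ}
    (hrange : ∀ X, E X ∈ N) (hid : ∀ X ∈ N, E X = X) (hone : E 1 = 1)
    (hpos : ∀ X : Matrix (Fin d) (Fin d) ℂ, X.PosSemidef → (E X).PosSemidef)
    (hEσ : ∀ X, (σ * E X).trace = (σ * X).trace)
    (hs : ∀ X Y, (Es X * Y).trace = (X * E Y).trace)
    (h0range : ∀ X, E0 X ∈ N) (h0id : ∀ X ∈ N, E0 X = X)
    (h0pos : ∀ X : Matrix (Fin d) (Fin d) ℂ, X.PosSemidef → (E0 X).PosSemidef)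
    (h0sa : ∀ X Y, (E0 X * Y).trace = (X * E0 Y).trace) :
    ∃ τ : Matrix (Fin d) (Fin d) ℂ, τ.PosDef ∧ (∀ a ∈ N, a.IsHermitian → Commute τ a) ∧
      (∀ Y : Matrix (Fin d) (Fin d) ℂ, Y.PosSemidef → Es Y = τ * E0 Y) ∧
      (∀ y ∈ N, (τ * y).trace = y.trace) ∧ σ = τ * E0 σ := by
  have hτ : (Es 1).PosSemidef := dual_pos hpos hs PosSemidef.one
  have hJ : ∀ Y : Matrix (Fin d) (Fin d) ℂ, Y.PosSemidef →
      (2 : ℂ) • Es Y = Es 1 * E0 Y + E0 Y * Es 1 := by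
    intro Y hY
    have hY0 := (h0pos Y hY).1
    have hEsY := (dual_pos hpos hs hY).1
    rw [← sub_eq_zero]
    set D := (2 : ℂ) • Es Y - (Es 1 * E0 Y + E0 Y * Es 1) with hD
    have hDH : D.IsHermitian := by
      rw [Matrix.IsHermitian, hD, conjTranspose_sub, conjTranspose_smul, conjTranspose_add,
        conjTranspose_mul, conjTranspose_mul, hEsY.eq, hY0.eq, hτ.1.eq, add_comm (E0 Y * Es 1)]
      simp
    have ht : ∀ Z : Matrix (Fin d) (Fin d) ℂ, Z.IsHermitian → (D * Z).trace = 0 := by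
      intro Z hZ
      have a1 : (Es Y * Z).trace = (E0 Y * E Z).trace := by
        rw [hs, h0sa, h0id _ (hrange Z)]
      have a2 : (E0 Y * E Z + E Z * E0 Y).trace = 2 * (E0 Y * E Z).trace := by
        rw [Matrix.trace_add, Matrix.trace_mul_comm (E Z)]; ring
      have a3 : (E0 Y * E Z + E Z * E0 Y).trace = (Es 1 * (E0 Y * Z + Z * E0 Y)).trace := by
        rw [hs, Matrix.one_mul, jordan hpos hone hid hY0 (h0range Y) hZ]
      have a4 : (Es 1 * (E0 Y * Z + Z * E0 Y)).trace
          = ((Es 1 * E0 Y + E0 Y * Es 1) * Z).trace := by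
        rw [Matrix.mul_add, Matrix.add_mul, Matrix.trace_add, Matrix.trace_add, Matrix.mul_assoc]
        congr 1
        rw [← Matrix.mul_assoc, Matrix.trace_mul_comm, ← Matrix.mul_assoc]
      rw [hD, Matrix.sub_mul, Matrix.trace_sub, Matrix.smul_mul, Matrix.trace_smul, a1, ← a4, ← a3,
        a2]
      simp
    have := ht D hDH
    nth_rewrite 1 [← hDH.eq] at this
    exact Matrix.trace_conjTranspose_mul_self_eq_zero_iff.1 this
  have hcomm : ∀ a ∈ N, a.IsHermitian → Commute (Es 1) a := by
    intro a haN ha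
    refine comm_of_jordan_pos (N := N) ?_ ha haN
    intro b hbN hb
    have := hJ b hb
    rw [h0id b hbN] at this
    rw [← this, two_smul]
    exact (dual_pos hpos hs hb).add (dual_pos hpos hs hb)
  have hEs : ∀ Y : Matrix (Fin d) (Fin d) ℂ, Y.PosSemidef → Es Y = Es 1 * E0 Y := by
    intro Y hY
    have h1 := hJ Y hY
    rw [← (hcomm _ (h0range Y) (h0pos Y hY).1).eq, ← two_smul ℂ] at h1
    exact smul_right_injective _ (two_ne_zero' ℂ) h1
  have hσfix : Es σ = σ := by
    rw [Matrix.ext_iff_trace_mul_right]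
    intro Z
    rw [hs, hEσ]
  have hσe : σ = Es 1 * E0 σ := by rw [← hEs σ hσ.posSemidef, hσfix]
  refine ⟨Es 1, ?_, hcomm, hEs, ?_, hσe⟩
  · rw [hτ.posDef_iff_det_ne_zero]
    intro h0
    have := hσ.det_pos
    rw [hσe, Matrix.det_mul, h0] at this
    simp at this
  · intro y hy
    rw [hs, Matrix.one_mul, hid y hy]

end ATCM
namespace ATCM
open Finset

lemma udu_inv {d : ℕ} {U : Matrix (Fin d) (Fin d) ℂ} (hU : Uᴴ * U = 1) (a : Fin d → ℝ) :
    Uᴴ * udu U a * U = diagonal (fun i => (a i : ℂ)) := by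
  unfold udu
  simp only [Matrix.mul_assoc, hU, Matrix.mul_one]
  rw [← Matrix.mul_assoc, hU, Matrix.one_mul]

lemma udu_trace {d : ℕ} {U : Matrix (Fin d) (Fin d) ℂ} (hU : Uᴴ * U = 1) (a : Fin d → ℝ) :
    ((udu U a).trace).re = ∑ i, a i := by
  unfold udu
  rw [Matrix.mul_assoc, Matrix.trace_mul_comm, Matrix.mul_assoc, hU, Matrix.mul_one,
    Matrix.trace_diagonal]
  simp

lemma udu_nonneg {d : ℕ} {U : Matrix (Fin d) (Fin d) ℂ} (hU : Uᴴ * U = 1) {a : Fin d → ℝ}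
    (h : (udu U a).PosSemidef) (i : Fin d) : 0 ≤ a i := by
  have h2 := h.conjTranspose_mul_mul_same U
  rw [udu_inv hU, Matrix.posSemidef_diagonal_iff] at h2
  simpa using h2 i

lemma udu_pos {d : ℕ} {U : Matrix (Fin d) (Fin d) ℂ} (hU : Uᴴ * U = 1) {a : Fin d → ℝ}
    (h : (udu U a).PosDef) (i : Fin d) : 0 < a i := by
  have h2 := h.conjTranspose_mul_mul_same (B := U) (by
    intro x y hxy
    have : Uᴴ *ᵥ (U *ᵥ x) = Uᴴ *ᵥ (U *ᵥ y) := congrArg _ hxy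
    simpa [Matrix.mulVec_mulVec, hU] using this)
  rw [udu_inv hU, Matrix.posDef_diagonal_iff] at h2
  simpa using h2 i

lemma udu_posDef {d : ℕ} {U : Matrix (Fin d) (Fin d) ℂ} (hU' : U * Uᴴ = 1) {a : Fin d → ℝ}
    (ha : ∀ i, 0 < a i) : (udu U a).PosDef := by
  unfold udu
  have h1 : (diagonal (fun i => (a i : ℂ))).PosDef := by
    rw [Matrix.posDef_diagonal_iff]
    intro i
    simpa using ha i
  apply h1.mul_mul_conjTranspose_same
  intro x y hxy
  have : (x ᵥ* U) ᵥ* Uᴴ = (y ᵥ* U) ᵥ* Uᴴ := congrArg (fun z => z ᵥ* Uᴴ) hxy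
  simpa [Matrix.vecMul_vecMul, hU'] using this

lemma cfc_prod {d : ℕ} {A B : Matrix (Fin d) (Fin d) ℂ} (hA : A.PosDef) (hB : B.PosDef)
    (hAB : Commute A B) {f : ℝ → ℝ} (hf : ∀ x y, 0 < x → 0 < y → f (x * y) = f x * f y) :
    cfc f (A * B) = cfc f A * cfc f B := by
  obtain ⟨U, a, b, hU, hU', rfl, rfl⟩ := joint_diag hA.1 hB.1 hAB
  have ha := udu_pos hU hA
  have hb := udu_pos hU hB
  rw [udu_mul hU, cfc_udu hU hU', cfc_udu hU hU', cfc_udu hU hU', udu_mul hU]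
  congr 1
  ext i
  exact hf _ _ (ha i) (hb i)

lemma posDef_prod {d : ℕ} {A B : Matrix (Fin d) (Fin d) ℂ} (hA : A.PosDef) (hB : B.PosDef)
    (hAB : Commute A B) : (A * B).PosDef := by
  obtain ⟨U, a, b, hU, hU', rfl, rfl⟩ := joint_diag hA.1 hB.1 hAB
  have ha := udu_pos hU hA
  have hb := udu_pos hU hB
  rw [udu_mul hU]
  exact udu_posDef hU' fun i => mul_pos (ha i) (hb i)

lemma log_prod {d : ℕ} {A B : Matrix (Fin d) (Fin d) ℂ} (hA : A.PosDef) (hB : B.PosDef)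
    (hAB : Commute A B) : matLog (A * B) = matLog A + matLog B := by
  obtain ⟨U, a, b, hU, hU', rfl, rfl⟩ := joint_diag hA.1 hB.1 hAB
  have ha := udu_pos hU hA
  have hb := udu_pos hU hB
  unfold matLog
  rw [udu_mul hU, cfc_udu hU hU', cfc_udu hU hU', cfc_udu hU hU', udu_add]
  congr 1
  ext i
  exact Real.log_mul (ha i).ne' (hb i).ne'

lemma cfc_pos {d : ℕ} {A : Matrix (Fin d) (Fin d) ℂ} (hA : A.PosDef) {f : ℝ → ℝ}
    (hf : ∀ x, 0 < x → 0 < f x) : (cfc f A).PosDef := by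
  obtain ⟨U, hU, hU', e⟩ := exists_udu hA.1
  have hp := hA.eigenvalues_pos
  rw [e, cfc_udu hU hU']
  exact udu_posDef hU' fun i => hf _ (hp i)

lemma cfc_mul' {d : ℕ} {A : Matrix (Fin d) (Fin d) ℂ} (hA : A.PosDef) {f g h : ℝ → ℝ}
    (hf : ∀ x, 0 < x → f x * g x = h x) : cfc f A * cfc g A = cfc h A := by
  obtain ⟨U, hU, hU', e⟩ := exists_udu hA.1
  have hp := hA.eigenvalues_pos
  rw [e, cfc_udu hU hU', cfc_udu hU hU', cfc_udu hU hU', udu_mul hU]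
  congr 1
  ext i
  exact hf _ (hp i)

lemma cfc_id_pd {d : ℕ} {A : Matrix (Fin d) (Fin d) ℂ} (hA : A.PosDef) :
    cfc (fun x : ℝ => x) A = A := by
  obtain ⟨U, hU, hU', e⟩ := exists_udu hA.1
  nth_rewrite 1 [e]
  rw [cfc_udu hU hU', ← e]

lemma cfc_one_pd {d : ℕ} {A : Matrix (Fin d) (Fin d) ℂ} (hA : A.PosDef) :
    cfc (fun _ : ℝ => (1 : ℝ)) A = 1 := by
  obtain ⟨U, hU, hU', e⟩ := exists_udu hA.1
  rw [e, cfc_udu hU hU', udu_const hU', one_smul]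

lemma conj_posDef {d : ℕ} {A K : Matrix (Fin d) (Fin d) ℂ} (hA : A.PosDef) (hK : K.PosDef) :
    (K * A * Kᴴ).PosDef := by
  apply hA.mul_mul_conjTranspose_same
  exact Matrix.vecMul_injective_of_isUnit hK.isUnit

lemma exists_lower {d : ℕ} {a : Fin d → ℝ} (ha : ∀ i, 0 < a i) : ∃ c > 0, ∀ i, c < a i := by
  have hn : ∀ i ∈ (univ : Finset (Fin d)), 0 ≤ (a i)⁻¹ := fun i _ => (inv_pos.2 (ha i)).le
  have hs : 0 ≤ ∑ i, (a i)⁻¹ := sum_nonneg hn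
  refine ⟨(∑ i, (a i)⁻¹ + 1)⁻¹, by positivity, fun i => ?_⟩
  apply inv_lt_of_inv_lt₀ (ha i)
  have := single_le_sum hn (mem_univ i)
  linarith

lemma E0_posDef {d : ℕ} {E0 : Matrix (Fin d) (Fin d) ℂ →ₗ[ℂ] Matrix (Fin d) (Fin d) ℂ}
    (h0one : E0 1 = 1)
    (h0pos : ∀ X : Matrix (Fin d) (Fin d) ℂ, X.PosSemidef → (E0 X).PosSemidef)
    {X : Matrix (Fin d) (Fin d) ℂ} (hX : X.PosDef) : (E0 X).PosDef := by
  obtain ⟨U, hU, hU', e⟩ := exists_udu hX.1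
  have hp := hX.eigenvalues_pos
  generalize hX.1.eigenvalues = a at e hp
  obtain ⟨c, hc, hca⟩ := exists_lower hp
  have e2 : X = udu U (fun i => a i - c) + (c : ℂ) • 1 := by
    have h1 := udu_add U (fun i => a i - c) (fun _ => c)
    rw [udu_const hU'] at h1
    simp only [sub_add_cancel] at h1
    rw [e, ← h1]
    simp
  rw [e2, map_add, map_smul, h0one]
  refine PosDef.posSemidef_add (h0pos _ (udu_psd U fun i => by linarith [hca i])) ?_
  exact PosDef.one.smul (by simpa using hc)

/-- Optimality of the conditional expectation. -/
lemma compare {d : ℕ} {N : StarSubalgebra ℂ (Matrix (Fin d) (Fin d) ℂ)}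
    {E0 : Matrix (Fin d) (Fin d) ℂ →ₗ[ℂ] Matrix (Fin d) (Fin d) ℂ}
    (h0range : ∀ X, E0 X ∈ N) (h0id : ∀ X ∈ N, E0 X = X) (h0one : E0 1 = 1)
    (h0pos : ∀ X : Matrix (Fin d) (Fin d) ℂ, X.PosSemidef → (E0 X).PosSemidef)
    (h0sa : ∀ X Y, (E0 X * Y).trace = (X * E0 Y).trace)
    {τ : Matrix (Fin d) (Fin d) ℂ} (hτ : τ.PosDef)
    (hcomm : ∀ a ∈ N, a.IsHermitian → Commute τ a)
    (htr : ∀ y ∈ N, (τ * y).trace = y.trace)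
    {ρ y : Matrix (Fin d) (Fin d) ℂ} (hρ : ρ.PosDef) (hy : y.PosDef) (hyN : y ∈ N) :
    DLin ρ (τ * E0 ρ) ≤ DLin ρ (τ * y) := by
  have he := E0_posDef h0one h0pos hρ
  have h := DLin_nonneg he hy
  have h1 : ∀ n ∈ N, (E0 ρ * n).trace = (ρ * n).trace := fun n hn => by rw [h0sa, h0id n hn]
  unfold DLin at h ⊢
  rw [log_prod hτ he (hcomm _ (h0range _) he.1), log_prod hτ hy (hcomm _ hyN hy.1),
    htr _ (h0range _), htr _ hyN]
  have m1 : matLog (E0 ρ) ∈ N := cfc_mem N he.1 (h0range _) _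
  have m2 : matLog y ∈ N := cfc_mem N hy.1 hyN _
  rw [h1 _ (sub_mem m1 m2)] at h
  simp only [Matrix.mul_sub, Matrix.mul_add, Matrix.trace_sub, Matrix.trace_add, Complex.sub_re,
    Complex.add_re] at h ⊢
  linarith

lemma conj_struct {d : ℕ} {N : StarSubalgebra ℂ (Matrix (Fin d) (Fin d) ℂ)}
    {τ s : Matrix (Fin d) (Fin d) ℂ} (hτ : τ.PosDef) (hs : s.PosDef) (hsN : s ∈ N)
    (hcomm : ∀ a ∈ N, a.IsHermitian → Commute τ a) {f : ℝ → ℝ}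
    (hf : ∀ x y, 0 < x → 0 < y → f (x * y) = f x * f y) (hf0 : ∀ x, 0 < x → 0 < f x)
    {e : Matrix (Fin d) (Fin d) ℂ} (he : e.PosDef) (heN : e ∈ N) :
    ∃ y ∈ N, y.PosDef ∧
      cfc f (τ * s) * e * (cfc f (τ * s))ᴴ = cfc f τ * cfc f τ * y ∧ Commute (cfc f τ) y
        := by
  have hq := cfc_pos hs hf0
  have hr := cfc_pos hτ hf0
  have hqN := cfc_mem N hs.1 hsN f
  have hK : (cfc f (τ * s)).PosDef := cfc_pos (posDef_prod hτ hs (hcomm _ hsN hs.1)) hf0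
  have hP := conj_posDef he hq
  rw [hq.1.eq] at hP
  have hN : cfc f s * e * cfc f s ∈ N := mul_mem (mul_mem hqN heN) hqN
  refine ⟨cfc f s * e * cfc f s, hN, hP, ?_, cfc_comm hτ.1 (hcomm _ hN hP.1) f⟩
  rw [hK.1.eq, cfc_prod hτ hs (hcomm _ hsN hs.1) hf]
  have c1 : Commute (cfc f τ) (cfc f s) := cfc_comm hτ.1 (hcomm _ hqN hq.1) f
  have c2 : Commute (cfc f τ) e := cfc_comm hτ.1 (hcomm _ heN he.1) f
  have c3 : Commute (cfc f τ) (cfc f s * e) := c1.mul_right c2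
  calc cfc f τ * cfc f s * e * (cfc f τ * cfc f s)
      = cfc f τ * ((cfc f s * e) * cfc f τ) * cfc f s := by simp only [Matrix.mul_assoc]
    _ = cfc f τ * (cfc f τ * (cfc f s * e)) * cfc f s := by rw [c3.eq]
    _ = _ := by simp only [Matrix.mul_assoc]

def isq (x : ℝ) : ℝ := (Real.sqrt x)⁻¹

lemma sqrt_m (x y : ℝ) (hx : 0 < x) (_ : 0 < y) : √(x * y) = √x * √y := Real.sqrt_mul hx.le y
lemma isq_m (x y : ℝ) (hx : 0 < x) (_ : 0 < y) : isq (x * y) = isq x * isq y := by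
  unfold isq; rw [Real.sqrt_mul hx.le y, mul_inv]
lemma isq_pos (x : ℝ) (hx : 0 < x) : 0 < isq x := inv_pos.2 (Real.sqrt_pos.2 hx)

lemma upper {d : ℕ} {N : StarSubalgebra ℂ (Matrix (Fin d) (Fin d) ℂ)}
    {E0 : Matrix (Fin d) (Fin d) ℂ →ₗ[ℂ] Matrix (Fin d) (Fin d) ℂ}
    (h0range : ∀ X, E0 X ∈ N) (h0id : ∀ X ∈ N, E0 X = X) (h0one : E0 1 = 1)
    (h0pos : ∀ X : Matrix (Fin d) (Fin d) ℂ, X.PosSemidef → (E0 X).PosSemidef)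
    (h0sa : ∀ X Y, (E0 X * Y).trace = (X * E0 Y).trace)
    {τ : Matrix (Fin d) (Fin d) ℂ} (hτ : τ.PosDef)
    (hcomm : ∀ a ∈ N, a.IsHermitian → Commute τ a)
    (htr : ∀ y ∈ N, (τ * y).trace = y.trace)
    {σ : Matrix (Fin d) (Fin d) ℂ} (hσ : σ.PosDef) (hσe : σ = τ * E0 σ)
    {X : Matrix (Fin d) (Fin d) ℂ} (hX : X.PosDef) {k : ℝ} (hk : 0 < k)
    (hkσ : (k • (1 : Matrix (Fin d) (Fin d) ℂ) - σ).PosSemidef)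
    {ρ : Matrix (Fin d) (Fin d) ℂ}
    (hρ : ρ = cfc Real.sqrt σ * X * (cfc Real.sqrt σ)ᴴ) :
    DLin ρ (τ * E0 ρ) ≤ k * DLin X (E0 X) := by
  have hs := E0_posDef h0one h0pos hσ
  have he := E0_posDef h0one h0pos hX
  have hK : (cfc Real.sqrt σ).PosDef := cfc_pos hσ fun x hx => Real.sqrt_pos.2 hx
  have hρP : ρ.PosDef := by rw [hρ]; exact conj_posDef hX hK
  obtain ⟨y, hyN, hyP, ey, -⟩ := conj_struct hτ hs (h0range _) hcomm sqrt_m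
    (fun x hx => Real.sqrt_pos.2 hx) he (h0range _)
  rw [← hσe, cfc_mul' hτ (h := fun x => x) (fun x hx => Real.mul_self_sqrt hx.le),
    cfc_id_pd hτ] at ey
  refine (compare h0range h0id h0one h0pos h0sa hτ hcomm htr hρP hyP hyN).trans ?_
  rw [← ey, hρ]
  refine DLin_dpi hX he (conj_posDef hX hK) (conj_posDef he hK) hk ?_
  rwa [hK.1.eq, cfc_mul' hσ (h := fun x => x) (fun x hx => Real.mul_self_sqrt hx.le), cfc_id_pd hσ]

lemma lower {d : ℕ} {N : StarSubalgebra ℂ (Matrix (Fin d) (Fin d) ℂ)}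
    {E0 : Matrix (Fin d) (Fin d) ℂ →ₗ[ℂ] Matrix (Fin d) (Fin d) ℂ}
    (h0range : ∀ X, E0 X ∈ N) (h0id : ∀ X ∈ N, E0 X = X) (h0one : E0 1 = 1)
    (h0pos : ∀ X : Matrix (Fin d) (Fin d) ℂ, X.PosSemidef → (E0 X).PosSemidef)
    (h0sa : ∀ X Y, (E0 X * Y).trace = (X * E0 Y).trace)
    {τ : Matrix (Fin d) (Fin d) ℂ} (hτ : τ.PosDef)
    (hcomm : ∀ a ∈ N, a.IsHermitian → Commute τ a)
    {σ : Matrix (Fin d) (Fin d) ℂ} (hσ : σ.PosDef) (hσe : σ = τ * E0 σ)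
    {X : Matrix (Fin d) (Fin d) ℂ} {k : ℝ} (hk : 0 < k)
    (hkσ : (k • (1 : Matrix (Fin d) (Fin d) ℂ) - cfc isq σ * (cfc isq σ)ᴴ).PosSemidef)
    {ρ : Matrix (Fin d) (Fin d) ℂ} (hρ : ρ.PosDef)
    (hX : X = cfc isq σ * ρ * (cfc isq σ)ᴴ) :
    DLin X (E0 X) ≤ k * DLin ρ (τ * E0 ρ) := by
  have hs := E0_posDef h0one h0pos hσ
  have he := E0_posDef h0one h0pos hρ
  have hL : (cfc isq σ).PosDef := cfc_pos hσ isq_pos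
  have hXP : X.PosDef := by rw [hX]; exact conj_posDef hρ hL
  have hτe := hcomm _ (h0range ρ) he.1
  obtain ⟨y, hyN, hyP, ey, hc⟩ := conj_struct hτ hs (h0range _) hcomm isq_m isq_pos he (h0range ρ)
  have hinv : cfc isq τ * cfc isq τ * τ = 1 := by
    nth_rewrite 3 [← cfc_id_pd hτ]
    rw [cfc_mul' hτ (h := fun x => x⁻¹) (fun x hx => by
      unfold isq; rw [← mul_inv, Real.mul_self_sqrt hx.le]),
      cfc_mul' hτ (h := fun _ => 1) (fun x hx => inv_mul_cancel₀ hx.ne'), cfc_one_pd hτ]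
  have ey2 : cfc isq σ * (τ * E0 ρ) * (cfc isq σ)ᴴ = y := by
    have cL : Commute τ (cfc isq σ) := by
      refine (cfc_comm hσ.1 ?_ isq).symm
      rw [hσe]
      exact (((Commute.refl τ).mul_right (hcomm _ (h0range _) hs.1))).symm
    rw [← hσe] at ey
    calc _ = τ * (cfc isq σ * E0 ρ * (cfc isq σ)ᴴ) := by
          rw [← Matrix.mul_assoc, ← cL.eq]; simp only [Matrix.mul_assoc]
      _ = (cfc isq τ * cfc isq τ * τ) * y := by
          rw [ey, ← Matrix.mul_assoc]
          congr 1
          have : Commute τ (cfc isq τ) := (cfc_comm hτ.1 (Commute.refl τ) isq).symm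
          exact (this.mul_right this).eq
      _ = y := by rw [hinv, Matrix.one_mul]
  have hcmp := compare h0range h0id h0one h0pos h0sa (τ := 1) PosDef.one
    (fun a _ _ => Commute.one_left a) (fun y _ => by rw [Matrix.one_mul]) hXP hyP hyN
  rw [Matrix.one_mul, Matrix.one_mul] at hcmp
  refine hcmp.trans ?_
  rw [← ey2, hX]
  have hτeP := posDef_prod hτ he hτe
  exact DLin_dpi hρ hτeP (conj_posDef hρ hL) (conj_posDef hτeP hL) hk hkσ

lemma relEnt_formula {d : ℕ} {N : StarSubalgebra ℂ (Matrix (Fin d) (Fin d) ℂ)}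
    {E0 : Matrix (Fin d) (Fin d) ℂ →ₗ[ℂ] Matrix (Fin d) (Fin d) ℂ}
    (h0range : ∀ X, E0 X ∈ N) (h0id : ∀ X ∈ N, E0 X = X)
    (h0pos : ∀ X : Matrix (Fin d) (Fin d) ℂ, X.PosSemidef → (E0 X).PosSemidef)
    (h0sa : ∀ X Y, (E0 X * Y).trace = (X * E0 Y).trace)
    {τ : Matrix (Fin d) (Fin d) ℂ} (hτ : τ.PosDef)
    (hcomm : ∀ a ∈ N, a.IsHermitian → Commute τ a)
    {ρ : Matrix (Fin d) (Fin d) ℂ} (hρ : ρ.PosSemidef) :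
    relEnt ρ (τ * E0 ρ) = ((cfc (fun x => x * Real.log x) ρ).trace).re
      - ((cfc (fun x => x * Real.log x) (E0 ρ)).trace).re - ((ρ * matLog τ).trace).re := by
  have h1 : ∀ n ∈ N, (E0 ρ * n).trace = (ρ * n).trace := fun n hn => by rw [h0sa, h0id n hn]
  have he := h0pos ρ hρ
  have a1 : ρ * matLog ρ = cfc (fun x => x * Real.log x) ρ := by
    obtain ⟨U, hU, hU', e⟩ := exists_udu hρ.1
    generalize hρ.1.eigenvalues = a at e
    unfold matLog
    rw [e, cfc_udu hU hU', cfc_udu hU hU', udu_mul hU]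
  have mN : matLog (E0 ρ) ∈ N := cfc_mem N he.1 (h0range _) _
  have a2 : E0 ρ * matLog (E0 ρ) = cfc (fun x => x * Real.log x) (E0 ρ) := by
    obtain ⟨U, hU, hU', e⟩ := exists_udu he.1
    generalize he.1.eigenvalues = a at e
    unfold matLog
    rw [e, cfc_udu hU hU', cfc_udu hU hU', udu_mul hU]
  have a3 : ((ρ * matLog (τ * E0 ρ)).trace).re
      = ((ρ * matLog τ).trace).re + ((ρ * matLog (E0 ρ)).trace).re := by
    let g : ℝ → ℝ := fun x => if x = 0 then 1 else 0
    have hPN : cfc g (E0 ρ) ∈ N := cfc_mem N he.1 (h0range _) _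
    have hP := h1 _ hPN
    obtain ⟨U, t, b, hU, hU', eτ, ee⟩ := joint_diag hτ.1 he.1 (hcomm _ (h0range ρ) he.1)
    rw [eτ] at hτ
    have ht := udu_pos hU hτ
    obtain ⟨V, hV, hV', er⟩ := exists_udu hρ.1
    have hv := hρ.eigenvalues_nonneg
    generalize hρ.1.eigenvalues = v at er hv
    rw [ee, cfc_udu hU hU', udu_mul hU] at hP
    have hP2 := congrArg Complex.re hP
    rw [udu_trace hU, er, trace_udu_mul] at hP2
    have hz : ∑ i, b i * g (b i) = 0 := by
      refine sum_eq_zero fun i _ => ?_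
      by_cases h : b i = 0 <;> simp [g, h]
    rw [hz] at hP2
    have hg : ∀ j, 0 ≤ g (b j) := fun j => by
      by_cases h : b j = 0 <;> simp [g, h]
    have hnn : ∀ i j, 0 ≤ Complex.normSq ((Vᴴ * U) i j) * (v i * g (b j)) := fun i j =>
      mul_nonneg (Complex.normSq_nonneg _) (mul_nonneg (hv i) (hg j))
    have hterm : ∀ i j, Complex.normSq ((Vᴴ * U) i j) * (v i * g (b j)) = 0 := by
      intro i j
      have := (sum_eq_zero_iff_of_nonneg (fun i _ => sum_nonneg fun j _ => hnn i j)).1 hP2.symm i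
        (mem_univ i)
      exact (sum_eq_zero_iff_of_nonneg (fun j _ => hnn i j)).1 this j (mem_univ j)
    rw [ee, eτ, er, udu_mul hU]
    unfold matLog
    rw [cfc_udu hU hU', cfc_udu hU hU', cfc_udu hU hU', trace_udu_mul, trace_udu_mul,
      trace_udu_mul, ← sum_add_distrib]
    refine sum_congr rfl fun i _ => ?_
    rw [← sum_add_distrib]
    refine sum_congr rfl fun j _ => ?_
    by_cases h : b j = 0
    · have := hterm i j
      simp only [g, h, if_true, mul_one] at this
      rw [← mul_assoc, ← mul_assoc, ← mul_assoc, this]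
      simp
    · rw [Real.log_mul (ht j).ne' h]
      ring
  unfold relEnt
  rw [Matrix.mul_sub, Matrix.trace_sub, Complex.sub_re, a3, a1, ← h1 _ mN, a2]
  ring

lemma tendsto_eta {d : ℕ} {A : Matrix (Fin d) (Fin d) ℂ} (hA : A.IsHermitian) :
    Filter.Tendsto (fun ε : ℝ => ((cfc (fun x => x * Real.log x) (A + (ε : ℂ) • 1)).trace).re)
      (nhdsWithin 0 (Set.Ioi 0)) (nhds ((cfc (fun x => x * Real.log x) A).trace).re) := by
  obtain ⟨U, hU, hU', e⟩ := exists_udu hA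
  generalize hA.eigenvalues = a at e
  have e2 : ∀ ε : ℝ, A + (ε : ℂ) • 1 = udu U (fun i => a i + ε) := by
    intro ε
    rw [← udu_add U a (fun _ => ε), udu_const hU', ← e]
    simp
  have e3 : (fun ε : ℝ => ((cfc (fun x => x * Real.log x) (A + (ε : ℂ) • 1)).trace).re)
      = fun ε => ∑ i, (a i + ε) * Real.log (a i + ε) := by
    ext ε
    rw [e2, cfc_udu hU hU', udu_trace hU]
  have e4 : ((cfc (fun x => x * Real.log x) A).trace).re
      = ∑ i, (a i + 0) * Real.log (a i + 0) := by
    rw [e, cfc_udu hU hU', udu_trace hU]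
    simp
  rw [e3, e4]
  have hc : Continuous fun ε : ℝ => ∑ i, (a i + ε) * Real.log (a i + ε) := by
    refine continuous_finsetSum _ fun i _ => ?_
    exact Real.continuous_mul_log.comp (continuous_const.add continuous_id)
  exact (hc.tendsto 0).mono_left nhdsWithin_le_nhds

lemma psd_eps {d : ℕ} {A : Matrix (Fin d) (Fin d) ℂ} (hA : A.PosSemidef) {ε : ℝ} (hε : 0 < ε) :
    (A + (ε : ℂ) • 1).PosDef :=
  PosDef.posSemidef_add hA (PosDef.one.smul (by simpa using hε))

lemma relEnt_tendsto {d : ℕ} {N : StarSubalgebra ℂ (Matrix (Fin d) (Fin d) ℂ)}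
    {E0 : Matrix (Fin d) (Fin d) ℂ →ₗ[ℂ] Matrix (Fin d) (Fin d) ℂ}
    (h0range : ∀ X, E0 X ∈ N) (h0id : ∀ X ∈ N, E0 X = X) (h0one : E0 1 = 1)
    (h0pos : ∀ X : Matrix (Fin d) (Fin d) ℂ, X.PosSemidef → (E0 X).PosSemidef)
    (h0sa : ∀ X Y, (E0 X * Y).trace = (X * E0 Y).trace)
    {τ : Matrix (Fin d) (Fin d) ℂ} (hτ : τ.PosDef)
    (hcomm : ∀ a ∈ N, a.IsHermitian → Commute τ a)
    {ρ : Matrix (Fin d) (Fin d) ℂ} (hρ : ρ.PosSemidef) :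
    Filter.Tendsto (fun ε : ℝ => relEnt (ρ + (ε : ℂ) • 1) (τ * E0 (ρ + (ε : ℂ) • 1)))
      (nhdsWithin 0 (Set.Ioi 0)) (nhds (relEnt ρ (τ * E0 ρ))) := by
  rw [relEnt_formula h0range h0id h0pos h0sa hτ hcomm hρ]
  have hlin : Filter.Tendsto (fun ε : ℝ => (((ρ + (ε : ℂ) • 1) * matLog τ).trace).re)
      (nhdsWithin 0 (Set.Ioi 0)) (nhds ((ρ * matLog τ).trace).re) := by
    have e : (fun ε : ℝ => (((ρ + (ε : ℂ) • 1) * matLog τ).trace).re)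
        = fun ε : ℝ => ((ρ * matLog τ).trace).re + ε * ((matLog τ).trace).re := by
      ext ε
      rw [Matrix.add_mul, Matrix.trace_add, Complex.add_re, Matrix.smul_mul, Matrix.one_mul,
        Matrix.trace_smul, smul_eq_mul, Complex.re_ofReal_mul]
    rw [e]
    have hc : Continuous fun ε : ℝ => ((ρ * matLog τ).trace).re + ε * ((matLog τ).trace).re := by
      fun_prop
    have := hc.tendsto 0
    simp only [zero_mul, add_zero] at this
    exact this.mono_left nhdsWithin_le_nhds
  refine (((tendsto_eta hρ.1).sub (tendsto_eta (h0pos ρ hρ).1)).sub hlin).congr' ?_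
  filter_upwards [self_mem_nhdsWithin] with ε hε
  have h := relEnt_formula h0range h0id h0pos h0sa hτ hcomm (psd_eps hρ hε).posSemidef
  rw [h, map_add, map_smul, h0one]

lemma DLin_eq_relEnt {d : ℕ} {A B : Matrix (Fin d) (Fin d) ℂ} (h : B.trace = A.trace) :
    DLin A B = relEnt A B := by
  unfold DLin relEnt
  rw [h]
  ring

end ATCM
/-- Approximate tensorization via noncommutative change of measure.
If the trace-preserving (HS self-adjoint) conditional expectations `E^{(0),M}, E₁^{(0)},
E₂^{(0)}` onto `M ⊆ N₁, N₂` satisfy `AT(1, c)` for the Lindblad relative entropy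
(infinite temperature), then the conditional expectations `E^M, E₁, E₂` compatible with a
full-rank state `σ` satisfy, for every density matrix `ρ`:
`D(ρ‖E^M_*(ρ)) ≤ (λ_max(σ)/λ_min(σ))(D(ρ‖E₁_*(ρ)) + D(ρ‖E₂_*(ρ))) + λ_max(σ)·d_H·c`. -/
theorem approximate_tensorization_change_of_measure
    {d : ℕ} (hd : 0 < d)
    (Malg N1 N2 : StarSubalgebra ℂ (Matrix (Fin d) (Fin d) ℂ))
    (hMN1 : Malg ≤ N1) (hMN2 : Malg ≤ N2)
    (σ : Matrix (Fin d) (Fin d) ℂ) (hσ : σ.PosDef) (hσtr : σ.trace = 1)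
    (EM E1 E2 EMs E1s E2s E0M E01 E02 :
      Matrix (Fin d) (Fin d) ℂ →ₗ[ℂ] Matrix (Fin d) (Fin d) ℂ)
    -- `EM`, `E1`, `E2` are conditional expectations compatible with `σ`:
    (hEMrange : ∀ X, EM X ∈ Malg) (hE1range : ∀ X, E1 X ∈ N1) (hE2range : ∀ X, E2 X ∈ N2)
    (hEMid : ∀ X ∈ Malg, EM X = X) (hE1id : ∀ X ∈ N1, E1 X = X) (hE2id : ∀ X ∈ N2, E2 X = X)
    (hEMunital : EM 1 = 1) (hE1unital : E1 1 = 1) (hE2unital : E2 1 = 1)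
    (hEMpos : ∀ X : Matrix (Fin d) (Fin d) ℂ, X.PosSemidef → (EM X).PosSemidef)
    (hE1pos : ∀ X : Matrix (Fin d) (Fin d) ℂ, X.PosSemidef → (E1 X).PosSemidef)
    (hE2pos : ∀ X : Matrix (Fin d) (Fin d) ℂ, X.PosSemidef → (E2 X).PosSemidef)
    (hEMσ : ∀ X, (σ * EM X).trace = (σ * X).trace)
    (hE1σ : ∀ X, (σ * E1 X).trace = (σ * X).trace)
    (hE2σ : ∀ X, (σ * E2 X).trace = (σ * X).trace)
    (hEMs : ∀ X Y, (EMs X * Y).trace = (X * EM Y).trace)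
    (hE1s : ∀ X Y, (E1s X * Y).trace = (X * E1 Y).trace)
    (hE2s : ∀ X Y, (E2s X * Y).trace = (X * E2 Y).trace)
    -- `E0M`, `E01`, `E02` are the trace-preserving (HS self-adjoint) conditional
    -- expectations onto the same algebras:
    (hE0Mrange : ∀ X, E0M X ∈ Malg) (hE01range : ∀ X, E01 X ∈ N1) (hE02range : ∀ X, E02 X ∈ N2)
    (hE0Mid : ∀ X ∈ Malg, E0M X = X) (hE01id : ∀ X ∈ N1, E01 X = X) (hE02id : ∀ X ∈ N2, E02 X = X)
    (hE0Munital : E0M 1 = 1) (hE01unital : E01 1 = 1) (hE02unital : E02 1 = 1)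
    (hE0Mpos : ∀ X : Matrix (Fin d) (Fin d) ℂ, X.PosSemidef → (E0M X).PosSemidef)
    (hE01pos : ∀ X : Matrix (Fin d) (Fin d) ℂ, X.PosSemidef → (E01 X).PosSemidef)
    (hE02pos : ∀ X : Matrix (Fin d) (Fin d) ℂ, X.PosSemidef → (E02 X).PosSemidef)
    (hE0Msa : ∀ X Y, (E0M X * Y).trace = (X * E0M Y).trace)
    (hE01sa : ∀ X Y, (E01 X * Y).trace = (X * E01 Y).trace)
    (hE02sa : ∀ X Y, (E02 X * Y).trace = (X * E02 Y).trace)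
    -- infinite-temperature approximate tensorization `AT(1, c)`:
    (c : ℝ)
    (hAT0 : ∀ X : Matrix (Fin d) (Fin d) ℂ, X.PosSemidef →
      DLin X (E0M X) ≤ DLin X (E01 X) + DLin X (E02 X) + c)
    (ρ : Matrix (Fin d) (Fin d) ℂ) (hρ : ρ.PosSemidef) (hρtr : ρ.trace = 1) :
    relEnt ρ (EMs ρ)
      ≤ ((⨆ i, hσ.1.eigenvalues i) / (⨅ i, hσ.1.eigenvalues i))
          * (relEnt ρ (E1s ρ) + relEnt ρ (E2s ρ))
        + (⨆ i, hσ.1.eigenvalues i) * d * c := by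
  obtain ⟨τM, hτM, hcM, hEM, htM, hσM⟩ := ATCM.struct hσ hEMrange hEMid hEMunital hEMpos hEMσ hEMs
    hE0Mrange hE0Mid hE0Mpos hE0Msa
  obtain ⟨τ1, hτ1, hc1, hE1, ht1, hσ1⟩ := ATCM.struct hσ hE1range hE1id hE1unital hE1pos hE1σ hE1s
    hE01range hE01id hE01pos hE01sa
  obtain ⟨τ2, hτ2, hc2, hE2, ht2, hσ2⟩ := ATCM.struct hσ hE2range hE2id hE2unital hE2pos hE2σ hE2s
    hE02range hE02id hE02pos hE02sa
  haveI : Nonempty (Fin d) := ⟨⟨0, hd⟩⟩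
  have hev := hσ.eigenvalues_pos
  have hle : ∀ i, hσ.1.eigenvalues i ≤ ⨆ i, hσ.1.eigenvalues i :=
    fun i => le_ciSup (Set.finite_range _).bddAbove i
  have hge : ∀ i, ⨅ i, hσ.1.eigenvalues i ≤ hσ.1.eigenvalues i :=
    fun i => ciInf_le (Set.finite_range _).bddBelow i
  have hmin : 0 < ⨅ i, hσ.1.eigenvalues i := by
    obtain ⟨i, hi⟩ := exists_eq_ciInf_of_finite (f := hσ.1.eigenvalues)
    rw [← hi]
    exact hev i
  have hmax : 0 < ⨆ i, hσ.1.eigenvalues i := (hev ⟨0, hd⟩).trans_le (hle _)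
  obtain ⟨U, hU, hU', eσ⟩ := ATCM.exists_udu hσ.1
  generalize (⨆ i, hσ.1.eigenvalues i) = kM at *
  generalize (⨅ i, hσ.1.eigenvalues i) = km at *
  generalize hσ.1.eigenvalues = l at *
  have hk1 : (kM • (1 : Matrix (Fin d) (Fin d) ℂ) - σ).PosSemidef := by
    have h1 := ATCM.udu_add U (fun i => kM - l i) l
    simp only [sub_add_cancel] at h1
    rw [ATCM.udu_const hU', ← eσ] at h1
    rw [← h1, add_sub_cancel_right]
    exact ATCM.udu_psd U fun i => by linarith [hle i]
  have hLH : (cfc ATCM.isq σ).PosDef := ATCM.cfc_pos hσ ATCM.isq_pos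
  have hKH : (cfc Real.sqrt σ).PosDef := ATCM.cfc_pos hσ fun x hx => Real.sqrt_pos.2 hx
  have hk2 : (km⁻¹ • (1 : Matrix (Fin d) (Fin d) ℂ)
      - cfc ATCM.isq σ * (cfc ATCM.isq σ)ᴴ).PosSemidef := by
    have e2 : cfc ATCM.isq σ * (cfc ATCM.isq σ)ᴴ = ATCM.udu U (fun i => (l i)⁻¹) := by
      rw [hLH.1.eq, ATCM.cfc_mul' hσ (h := fun x => x⁻¹) (fun x hx => by
        unfold ATCM.isq; rw [← mul_inv, Real.mul_self_sqrt hx.le]), eσ, ATCM.cfc_udu hU hU']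
    have h1 := ATCM.udu_add U (fun i => km⁻¹ - (l i)⁻¹) (fun i => (l i)⁻¹)
    simp only [sub_add_cancel] at h1
    rw [ATCM.udu_const hU'] at h1
    rw [e2, ← h1, add_sub_cancel_right]
    exact ATCM.udu_psd U fun i => sub_nonneg.2 (inv_anti₀ hmin (hge i))
  have hc : 0 ≤ c := by
    have h := hAT0 1 PosSemidef.one
    rw [hE0Munital, hE01unital, hE02unital] at h
    have h0 : DLin (1 : Matrix (Fin d) (Fin d) ℂ) 1 = 0 := by simp [DLin]
    rw [h0] at h
    linarith
  -- positive definite case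
  have main : ∀ R : Matrix (Fin d) (Fin d) ℂ, R.PosDef →
      relEnt R (τM * E0M R) ≤ kM / km * (relEnt R (τ1 * E01 R) + relEnt R (τ2 * E02 R))
        + kM * d * c := by
    intro R hR
    set X := cfc ATCM.isq σ * R * (cfc ATCM.isq σ)ᴴ with hX
    have hXP : X.PosDef := ATCM.conj_posDef hR hLH
    have hKL : cfc Real.sqrt σ * cfc ATCM.isq σ = 1 := by
      rw [ATCM.cfc_mul' hσ (h := fun _ => 1) (fun x hx => by
        unfold ATCM.isq; exact mul_inv_cancel₀ (Real.sqrt_pos.2 hx).ne'), ATCM.cfc_one_pd hσ]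
    have hRX : R = cfc Real.sqrt σ * X * (cfc Real.sqrt σ)ᴴ := by
      have hLK : (cfc ATCM.isq σ)ᴴ * (cfc Real.sqrt σ)ᴴ = 1 := by
        rw [← conjTranspose_mul, hKL, conjTranspose_one]
      rw [hX]
      calc R = (cfc Real.sqrt σ * cfc ATCM.isq σ) * R
              * ((cfc ATCM.isq σ)ᴴ * (cfc Real.sqrt σ)ᴴ) := by
            rw [hKL, hLK, Matrix.one_mul, Matrix.mul_one]
        _ = _ := by simp only [Matrix.mul_assoc]
    have hu := ATCM.upper hE0Mrange hE0Mid hE0Munital hE0Mpos hE0Msa hτM hcM htM hσ hσM hXP hmax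
      hk1 hRX
    have hl1 := ATCM.lower hE01range hE01id hE01unital hE01pos hE01sa hτ1 hc1 hσ hσ1
      (inv_pos.2 hmin) hk2 hR hX
    have hl2 := ATCM.lower hE02range hE02id hE02unital hE02pos hE02sa hτ2 hc2 hσ hσ2
      (inv_pos.2 hmin) hk2 hR hX
    have h0 := hAT0 X hXP.posSemidef
    have tr : ∀ {N : StarSubalgebra ℂ (Matrix (Fin d) (Fin d) ℂ)}
        {E0 : Matrix (Fin d) (Fin d) ℂ →ₗ[ℂ] Matrix (Fin d) (Fin d) ℂ}
        {τ : Matrix (Fin d) (Fin d) ℂ}, (∀ X, E0 X ∈ N) → E0 1 = 1 →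
        (∀ X Y, (E0 X * Y).trace = (X * E0 Y).trace) →
        (∀ y ∈ N, (τ * y).trace = y.trace) → (τ * E0 R).trace = R.trace := by
      intro N E0 τ a1 a2 a3 a4
      rw [a4 _ (a1 R)]
      have := a3 R 1
      rwa [a2, Matrix.mul_one, Matrix.mul_one] at this
    rw [ATCM.DLin_eq_relEnt (tr hE0Mrange hE0Munital hE0Msa htM)] at hu
    rw [ATCM.DLin_eq_relEnt (tr hE01range hE01unital hE01sa ht1)] at hl1
    rw [ATCM.DLin_eq_relEnt (tr hE02range hE02unital hE02sa ht2)] at hl2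
    have hd1 : (1 : ℝ) ≤ d := by exact_mod_cast hd
    have hdc : kM * c ≤ kM * d * c := by
      have : 0 ≤ kM * c := mul_nonneg hmax.le hc
      nlinarith
    calc _ ≤ kM * DLin X (E0M X) := hu
      _ ≤ kM * (km⁻¹ * relEnt R (τ1 * E01 R) + km⁻¹ * relEnt R (τ2 * E02 R) + c) := by
          apply mul_le_mul_of_nonneg_left _ hmax.le
          linarith
      _ = kM / km * (relEnt R (τ1 * E01 R) + relEnt R (τ2 * E02 R)) + kM * c := by
          rw [div_eq_mul_inv]; ring
      _ ≤ _ := by linarith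
  rw [hEM ρ hρ, hE1 ρ hρ, hE2 ρ hρ]
  have tM := ATCM.relEnt_tendsto hE0Mrange hE0Mid hE0Munital hE0Mpos hE0Msa hτM hcM hρ
  have t1 := ATCM.relEnt_tendsto hE01range hE01id hE01unital hE01pos hE01sa hτ1 hc1 hρ
  have t2 := ATCM.relEnt_tendsto hE02range hE02id hE02unital hE02pos hE02sa hτ2 hc2 hρ
  refine le_of_tendsto_of_tendsto tM (((t1.add t2).const_mul (kM / km)).add_const (kM * d * c)) ?_
  filter_upwards [self_mem_nhdsWithin] with ε hε
  exact main _ (ATCM.psd_eps hρ hε)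

end
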